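/- Let d ≥ 4 and let P be a centrally symmetric simplicial d-polytope with g_2(P) = C(d,2) − d such that ∂P contains a missing facet. Then there exist simplicial d-polytopes Q and P' with P = Q ∪ P' ∪ (−Q), where Q, P', and −Q have pairwise disjoint interiors, Q ∩ P' is a common facet of Q and of P', (−Q) ∩ P' is the antipodal common facet, Q ∩ (−Q) = ∅, every vertex of Q and of P' is a vertex of P, Q is a stacked d-polytope, and P' is a centrally symmetric simplicial d-polytope with g_2(P') = C(d,2) − d. -/

import Mathlib

open Finset
open scoped Classical

noncomputable section

/-- A finite graph: a finite vertex set together with a finite set of edges,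
where each edge is (intended to be) a 2-element subset of the vertex set. -/
structure FinGraph (ι : Type) where
  verts : Finset ι
  edges : Finset (Finset ι)

/-- Every edge is a 2-element subset of the vertex set. -/
def FinGraph.Good {ι : Type} (G : FinGraph ι) : Prop :=
  ∀ e ∈ G.edges, e ⊆ G.verts ∧ e.card = 2

/-- The standard inner (dot) product on `ℝ^d`. -/
def dotR {d : ℕ} (x y : Fin d → ℝ) : ℝ := ∑ i, x i * y i

/-- An infinitesimal motion of the framework `(G, p)`. -/
def IsMotion {ι : Type} {d : ℕ} (G : FinGraph ι) (p m : ι → Fin d → ℝ) : Prop :=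
  ∀ e ∈ G.edges, ∀ u ∈ e, ∀ v ∈ e, dotR (p u - p v) (m u - m v) = 0

/-- The framework `(G, p)` is infinitesimally rigid in `ℝ^d`: every infinitesimal
motion is the restriction of a motion `x ↦ A x + b` of `ℝ^d` with `A` skew-symmetric. -/
def IsInfRigid {ι : Type} (d : ℕ) (G : FinGraph ι) (p : ι → Fin d → ℝ) : Prop :=
  ∀ m : ι → Fin d → ℝ, IsMotion G p m →
    ∃ (A : Matrix (Fin d) (Fin d) ℝ) (b : Fin d → ℝ),
      A.transpose = -A ∧ ∀ v ∈ G.verts, m v = A.mulVec (p v) + b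

/-- A stress on the framework `(G, p)`. -/
def IsStress {ι : Type} {d : ℕ} (G : FinGraph ι) (p : ι → Fin d → ℝ)
    (ω : Finset ι → ℝ) : Prop :=
  ∀ v ∈ G.verts,
    (∑ e ∈ G.edges.filter (fun e => v ∈ e), ∑ u ∈ e.erase v, ω e • (p v - p u)) = 0

/-- A centrally symmetric framework with free involution `ν` satisfying `p (ν v) = -(p v)`. -/
def IsCSFramework {ι : Type} {d : ℕ} (G : FinGraph ι) (p : ι → Fin d → ℝ) (ν : ι → ι) : Prop :=
  (∀ v ∈ G.verts, ν (ν v) = v) ∧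
  (∀ v ∈ G.verts, ν v ∈ G.verts) ∧
  (∀ v ∈ G.verts, ν v ≠ v) ∧
  (∀ e ∈ G.edges, e.image ν ∈ G.edges) ∧
  (∀ e ∈ G.edges, e.image ν ≠ e) ∧
  (∀ v ∈ G.verts, p (ν v) = -(p v))

/-- The convex body spanned by a finite point set. -/
def polyBody {d : ℕ} (V : Finset (Fin d → ℝ)) : Set (Fin d → ℝ) :=
  convexHull ℝ (V : Set (Fin d → ℝ))

/-- `(f, c)` is a supporting functional for `conv V` exposing the face `F`. -/
def IsSupport {d : ℕ} (V : Finset (Fin d → ℝ)) (f : (Fin d → ℝ) →ₗ[ℝ] ℝ) (c : ℝ)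
    (F : Set (Fin d → ℝ)) : Prop :=
  (∀ y ∈ polyBody V, f y ≤ c) ∧ F = {y ∈ polyBody V | f y = c}

/-- A proper face of the polytope `conv V`. -/
def IsProperFace {d : ℕ} (V : Finset (Fin d → ℝ)) (F : Set (Fin d → ℝ)) : Prop :=
  (∃ f c, IsSupport V f c F) ∧ F ≠ polyBody V

/-- A simplicial `d`-polytope in `ℝ^d`, recorded by its vertex set `V`: the polytope is
`conv V`, it is `d`-dimensional, every element of `V` is a vertex, and every proper face
is a simplex (the convex hull of its affinely independent vertex set). -/
structure SPolytope (d : ℕ) where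
  V : Finset (Fin d → ℝ)
  span_top : affineSpan ℝ (V : Set (Fin d → ℝ)) = ⊤
  extreme : ∀ v ∈ V, v ∉ convexHull ℝ ((V.erase v : Finset (Fin d → ℝ)) : Set (Fin d → ℝ))
  simplicial : ∀ F : Set (Fin d → ℝ), IsProperFace V F →
    AffineIndependent ℝ
      (fun x : {y : Fin d → ℝ // y ∈ (V : Set (Fin d → ℝ)) ∩ F} => (x : Fin d → ℝ)) ∧
    F = convexHull ℝ ((V : Set (Fin d → ℝ)) ∩ F)

/-- `s` is a face of the boundary complex `∂P`. -/
def BFace {d : ℕ} (P : SPolytope d) (s : Finset (Fin d → ℝ)) : Prop :=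
  s ⊆ P.V ∧ ∃ F : Set (Fin d → ℝ), IsProperFace P.V F ∧ (s : Set (Fin d → ℝ)) ⊆ F

/-- The number of vertices of `∂P`. -/
def f0 {d : ℕ} (P : SPolytope d) : ℕ := P.V.card

/-- The edges of `∂P`. -/
def edgeFinset {d : ℕ} (P : SPolytope d) : Finset (Finset (Fin d → ℝ)) :=
  P.V.powerset.filter fun e => e.card = 2 ∧ BFace P e

/-- The number of edges of `∂P`. -/
def f1 {d : ℕ} (P : SPolytope d) : ℕ := (edgeFinset P).card

/-- `g₂(P) = f₁ - d f₀ + C(d+1, 2)`. -/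
def g2 {d : ℕ} (P : SPolytope d) : ℤ :=
  (f1 P : ℤ) - (d : ℤ) * (f0 P : ℤ) + ((d + 1).choose 2 : ℤ)

/-- `P` is centrally symmetric. -/
def IsCS {d : ℕ} (P : SPolytope d) : Prop := ∀ v ∈ P.V, -v ∈ P.V

/-- A missing face of `∂P`. -/
def IsMissingFace {d : ℕ} (P : SPolytope d) (σ : Finset (Fin d → ℝ)) : Prop :=
  σ ⊆ P.V ∧ ¬ BFace P σ ∧ ∀ τ ⊂ σ, BFace P τ

/-- `P` is prime: `∂P` has no missing facet, i.e. no missing face of cardinality `d`. -/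
def IsPrimePoly {d : ℕ} (P : SPolytope d) : Prop :=
  ¬ ∃ σ : Finset (Fin d → ℝ), IsMissingFace P σ ∧ σ.card = d

/-- The graph (1-skeleton) of `∂P` as a framework graph. -/
def fullGraph {d : ℕ} (P : SPolytope d) : FinGraph (Fin d → ℝ) :=
  ⟨P.V, edgeFinset P⟩

/-- The graph (1-skeleton) of the star of the face `τ` in `∂P`. -/
def starGraph {d : ℕ} (P : SPolytope d) (τ : Finset (Fin d → ℝ)) : FinGraph (Fin d → ℝ) :=
  ⟨P.V.filter fun v => BFace P (insert v τ),
   P.V.powerset.filter fun e => e.card = 2 ∧ BFace P (e ∪ τ)⟩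

/-- Adjacency in the graph of `∂P`. -/
def Adj {d : ℕ} (P : SPolytope d) (u v : Fin d → ℝ) : Prop :=
  u ≠ v ∧ BFace P {u, v}

/-- `σ` is a face of the link of the face `τ` in `∂P`. -/
def LinkFace {d : ℕ} (P : SPolytope d) (τ σ : Finset (Fin d → ℝ)) : Prop :=
  Disjoint σ τ ∧ BFace P (σ ∪ τ)

/-- `P` is a `d`-dimensional cross-polytope: its vertex set is `{±b₁, …, ±b_d}`
for some basis `b₁, …, b_d` of `ℝ^d`. -/
def IsCrossPolytope {d : ℕ} (P : SPolytope d) : Prop :=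
  ∃ b : Fin d → (Fin d → ℝ), LinearIndependent ℝ b ∧
    (P.V : Set (Fin d → ℝ)) = Set.range b ∪ Set.range (fun i => -(b i))

/-- A facet of `P`: a proper face with `d` vertices. -/
def IsFacet {d : ℕ} (P : SPolytope d) (F : Set (Fin d → ℝ)) : Prop :=
  IsProperFace P.V F ∧ ((P.V : Set (Fin d → ℝ)) ∩ F).ncard = d

/-- `x` lies beyond exactly one facet of `P`: it is strictly separated from `P` by the
affine hull of one facet `F`, and not separated from `P` by the affine hull of any
other facet. -/
def BeyondExactlyOne {d : ℕ} (P : SPolytope d) (x : Fin d → ℝ) : Prop :=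
  ∃ F : Set (Fin d → ℝ), IsFacet P F ∧
    (∀ f c, IsSupport P.V f c F → c < f x) ∧
    (∀ F' : Set (Fin d → ℝ), IsFacet P F' → F' ≠ F →
      ∀ f c, IsSupport P.V f c F' → f x < c)

/-- `P` is obtained from a `d`-dimensional cross-polytope by symmetric stacking: there is
a sequence of cs simplicial `d`-polytopes starting at a cross-polytope and ending at `P`,
each obtained from the previous one as `conv (P_k ∪ {v, -v})` for a point `v` lying
beyond exactly one facet of `P_k`. -/
def SymmetricStackingFrom {d : ℕ} (P : SPolytope d) : Prop :=
  ∃ (m : ℕ) (Q : Fin (m + 1) → SPolytope d),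
    (∀ k, IsCS (Q k)) ∧
    IsCrossPolytope (Q 0) ∧
    Q (Fin.last m) = P ∧
    ∀ k : Fin m, ∃ v : Fin d → ℝ,
      BeyondExactlyOne (Q (Fin.castSucc k)) v ∧
      polyBody (Q (Fin.succ k)).V =
        convexHull ℝ (polyBody (Q (Fin.castSucc k)).V ∪ {v, -v})

/-- `P` is a stacked `d`-polytope: obtained from a `d`-simplex by repeatedly adding a
point beyond exactly one facet. -/
def IsStacked {d : ℕ} (P : SPolytope d) : Prop :=
  ∃ (m : ℕ) (R : Fin (m + 1) → SPolytope d),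
    (R 0).V.card = d + 1 ∧
    R (Fin.last m) = P ∧
    ∀ k : Fin m, ∃ v : Fin d → ℝ,
      BeyondExactlyOne (R (Fin.castSucc k)) v ∧
      polyBody (R (Fin.succ k)).V =
        convexHull ℝ (polyBody (R (Fin.castSucc k)).V ∪ {v})

/-- Every `d` vertices of `P`, no two of which are antipodal, are affinely independent. -/
def GenPos {d : ℕ} (P : SPolytope d) : Prop :=
  ∀ S : Finset (Fin d → ℝ), S ⊆ P.V → S.card = d →
    (∀ x ∈ S, ∀ y ∈ S, x ≠ -y) →
    AffineIndependent ℝ (fun s : {x : Fin d → ℝ // x ∈ S} => (s : Fin d → ℝ))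

/-- The graph of the cone `v₀ * S` over a simplicial complex `S` (a set of finsets):
the vertices of `S` together with `v₀`, and the edges of `S` together with all edges
from `v₀` to vertices of `S`. -/
def coneGraph {d : ℕ} (P : SPolytope d) (v0 : Fin d → ℝ)
    (S : Set (Finset (Fin d → ℝ))) : FinGraph (Fin d → ℝ) :=
  ⟨insert v0 (P.V.filter fun u => ({u} : Finset (Fin d → ℝ)) ∈ S),
   (P.V.powerset.filter fun e => e.card = 2 ∧ e ∈ S) ∪
     (P.V.filter fun u => ({u} : Finset (Fin d → ℝ)) ∈ S).image
       fun u => ({v0, u} : Finset (Fin d → ℝ))⟩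


/-- Twice the signed area of a planar triangle. -/
def plD {κ : Type*} (X Y : κ → ℝ) (u v w : κ) : ℝ :=
  (X v - X u) * (Y w - Y u) - (X w - X u) * (Y v - Y u)

/-- Normalised height of `f` at `w` relative to its values at `u`, `v`. -/
def plK {κ : Type*} (X Y f : κ → ℝ) (u v w : κ) : ℝ :=
  ((f w - f u) - (f v - f u) * (((X v - X u) * (X w - X u) + (Y v - Y u) * (Y w - Y u)) /
    ((X v - X u) ^ 2 + (Y v - Y u) ^ 2))) / |plD X Y u v w|

/-- The trilinear form. -/
def plT {κ : Type*} [Fintype κ] (Tri : κ → κ → κ → Prop) (X Y f g h : κ → ℝ) : ℝ :=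
  ∑ u, ∑ v, ∑ w, if Tri u v w then plK X Y f u v w * ((g v - g u) * (h v - h u)) else 0

lemma sum_cyc {κ : Type*} [Fintype κ] (t : κ → κ → κ → ℝ) :
    ∑ u, ∑ v, ∑ w, t u v w = ∑ u, ∑ v, ∑ w, t v w u := by
  calc ∑ u, ∑ v, ∑ w, t u v w = ∑ v, ∑ u, ∑ w, t u v w := Finset.sum_comm
    _ = ∑ v, ∑ w, ∑ u, t u v w := by
        refine Finset.sum_congr rfl fun v _ => Finset.sum_comm
    _ = ∑ w, ∑ v, ∑ u, t u v w := Finset.sum_comm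
    _ = ∑ w, ∑ u, ∑ v, t u v w := by
        refine Finset.sum_congr rfl fun v _ => Finset.sum_comm

lemma plD_cyc {κ : Type*} (X Y : κ → ℝ) (u v w : κ) : plD X Y v w u = plD X Y u v w := by
  unfold plD; ring

lemma plT_symm {κ : Type*} [Fintype κ] (Tri : κ → κ → κ → Prop)
    (hcyc : ∀ u v w, Tri u v w → Tri v w u) (X Y f g h : κ → ℝ) :
    plT Tri X Y f g h = plT Tri X Y g f h := by
  have hc : ∀ u v w, Tri v w u ↔ Tri u v w := fun u v w =>
    ⟨fun a => hcyc _ _ _ (hcyc _ _ _ a), hcyc u v w⟩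
  rw [← sub_eq_zero]
  unfold plT
  simp only [← Finset.sum_sub_distrib]
  set t : κ → κ → κ → ℝ := fun u v w =>
    (if Tri u v w then plK X Y f u v w * ((g v - g u) * (h v - h u)) else 0) -
    (if Tri u v w then plK X Y g u v w * ((f v - f u) * (h v - h u)) else 0) with ht
  change ∑ u, ∑ v, ∑ w, t u v w = 0
  have h3 : ∀ u v w, t u v w + t v w u + t w u v = 0 := by
    intro u v w
    have e1 : ∀ a b c, Tri a b c → t a b c =
        ((f c - f a) * (g b - g a) - (g c - g a) * (f b - f a)) / |plD X Y a b c| *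
          (h b - h a) := by
      intro a b c h1
      simp only [ht, h1, if_true, plK]
      ring
    by_cases h1 : Tri u v w
    · have h2 : Tri v w u := (hc _ _ _).2 h1
      have h4 : Tri w u v := (hc _ _ _).2 h2
      rw [e1 _ _ _ h1, e1 _ _ _ h2, e1 _ _ _ h4, plD_cyc X Y u v w,
        plD_cyc X Y v w u, plD_cyc X Y u v w]
      ring
    · have h2 : ¬ Tri v w u := fun a => h1 ((hc _ _ _).1 a)
      have h4 : ¬ Tri w u v := fun a => h2 ((hc _ _ _).1 a)
      simp [ht, h1, h2, h4]
  have s1 := sum_cyc t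
  have s2 := sum_cyc (fun u v w => t v w u)
  have s3 : ∑ u, ∑ v, ∑ w, t u v w + ∑ u, ∑ v, ∑ w, t v w u + ∑ u, ∑ v, ∑ w, t w u v = 0 := by
    simp only [← Finset.sum_add_distrib]
    exact Finset.sum_eq_zero fun u _ => Finset.sum_eq_zero fun v _ =>
      Finset.sum_eq_zero fun w _ => h3 u v w
  linarith

lemma plT_eq {κ : Type*} [Fintype κ] (Tri : κ → κ → κ → Prop) (X Y f g h : κ → ℝ) :
    plT Tri X Y f g h = ∑ u, ∑ v, ((g v - g u) * (h v - h u)) *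
      ∑ w, if Tri u v w then plK X Y f u v w else 0 := by
  unfold plT
  refine Finset.sum_congr rfl fun u _ => Finset.sum_congr rfl fun v _ => ?_
  rw [Finset.mul_sum]
  refine Finset.sum_congr rfl fun w _ => ?_
  split_ifs <;> ring

/-- `k` of an affine function. -/
lemma plK_affine {κ : Type*} (X Y f : κ → ℝ) (g1 g2 g0 e : ℝ) (u v w : κ)
    (hu : f u = g1 * X u + g2 * Y u + g0) (hv : f v = g1 * X v + g2 * Y v + g0)
    (hw : f w = g1 * X w + g2 * Y w + g0 + e) (hD : plD X Y u v w ≠ 0) :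
    plK X Y f u v w = (g2 * (X v - X u) - g1 * (Y v - Y u)) /
      ((X v - X u) ^ 2 + (Y v - Y u) ^ 2) * (plD X Y u v w / |plD X Y u v w|)
        + e / |plD X Y u v w| := by
  have hE : (X v - X u) ^ 2 + (Y v - Y u) ^ 2 ≠ 0 := by
    intro h
    have h1 : X v - X u = 0 := by nlinarith [sq_nonneg (X v - X u), sq_nonneg (Y v - Y u)]
    have h2 : Y v - Y u = 0 := by nlinarith [sq_nonneg (X v - X u), sq_nonneg (Y v - Y u)]
    apply hD; unfold plD; rw [h1, h2]; ring
  have hD' : |plD X Y u v w| ≠ 0 := abs_ne_zero.2 hD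
  unfold plK
  rw [hu, hv, hw]
  field_simp
  unfold plD
  ring

lemma planar_energy {κ : Type*} [Fintype κ] (Tri : κ → κ → κ → Prop)
    (hcyc : ∀ u v w, Tri u v w → Tri v w u) (X Y Φ Z ξ η : κ → ℝ)
    (hD : ∀ u v w, Tri u v w → plD X Y u v w ≠ 0)
    (H1 : ∀ u v w, Tri u v w → (X v - X u) * (ξ v - ξ u) + (Y v - Y u) * (η v - η u)
      + (Φ v - Φ u) * (Z v - Z u) = 0)
    (H2 : ∀ u v w, Tri u v w → Z u = Z v ∨ ∃ p q, p ≠ q ∧ (∀ x, Tri u v x ↔ x = p ∨ x = q) ∧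
      plD X Y u v p * plD X Y u v q < 0 ∧ ∃ g1 g2 g0 : ℝ, Φ u = g1 * X u + g2 * Y u + g0 ∧
        Φ v = g1 * X v + g2 * Y v + g0 ∧ Φ p = g1 * X p + g2 * Y p + g0 ∧
        g1 * X q + g2 * Y q + g0 < Φ q) :
    ∀ u v w, Tri u v w → Z u = Z v := by
  have key : plT Tri X Y X Z ξ + plT Tri X Y Y Z η + plT Tri X Y Φ Z Z = 0 := by
    rw [plT_symm Tri hcyc X Y X Z, plT_symm Tri hcyc X Y Y Z, plT_symm Tri hcyc X Y Φ Z]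
    unfold plT
    simp only [← Finset.sum_add_distrib]
    refine Finset.sum_eq_zero fun u _ => Finset.sum_eq_zero fun v _ =>
      Finset.sum_eq_zero fun w _ => ?_
    split_ifs with h
    · have := H1 u v w h
      linear_combination plK X Y Z u v w * this
    · ring
  have sgn : ∀ a b : ℝ, a * b < 0 → a / |a| + b / |b| = 0 := by
    intro a b hab
    rcases mul_neg_iff.1 hab with ⟨h1, h2⟩ | ⟨h1, h2⟩
    · rw [abs_of_pos h1, abs_of_neg h2, div_self h1.ne', div_neg, div_self h2.ne]; ring
    · rw [abs_of_neg h1, abs_of_pos h2, div_self h2.ne', div_neg, div_self h1.ne]; ring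
  have sumw : ∀ u v p q (F : κ → ℝ), p ≠ q → (∀ x, Tri u v x ↔ x = p ∨ x = q) →
      (∑ w, if Tri u v w then F w else 0) = F p + F q := by
    intro u v p q F hpq hx
    rw [← Finset.sum_filter]
    have : Finset.univ.filter (fun w => Tri u v w) = {p, q} := by
      ext x; simp [hx]
    rw [this, Finset.sum_pair hpq]
  have noTri : ∀ u v (F : κ → ℝ), (∀ w, ¬ Tri u v w) → (∑ w, if Tri u v w then F w else 0) = 0 := by
    intro u v F h
    simp [h]
  have aff : ∀ (g1 g2 g0 : ℝ) (f h : κ → ℝ), (∀ x, f x = g1 * X x + g2 * Y x + g0) →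
      plT Tri X Y f Z h = 0 := by
    intro g1 g2 g0 f h hf
    rw [plT_eq]
    refine Finset.sum_eq_zero fun u _ => Finset.sum_eq_zero fun v _ => ?_
    by_cases hw : ∃ w, Tri u v w
    · obtain ⟨w, hw⟩ := hw
      rcases H2 u v w hw with h0 | ⟨p, q, hpq, hx, hneg, -⟩
      · rw [h0]; ring
      · rw [sumw u v p q _ hpq hx]
        have hp : Tri u v p := (hx p).2 (Or.inl rfl)
        have hq : Tri u v q := (hx q).2 (Or.inr rfl)
        rw [plK_affine X Y f g1 g2 g0 0 u v p (hf u) (hf v) (by rw [hf]; ring) (hD _ _ _ hp),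
          plK_affine X Y f g1 g2 g0 0 u v q (hf u) (hf v) (by rw [hf]; ring) (hD _ _ _ hq)]
        have := sgn _ _ hneg
        linear_combination ((Z v - Z u) * (h v - h u)) *
          ((g2 * (X v - X u) - g1 * (Y v - Y u)) /
          ((X v - X u) ^ 2 + (Y v - Y u) ^ 2)) * this
    · push Not at hw
      rw [noTri u v _ hw]; ring
  rw [aff 1 0 0 X ξ (by intro x; ring), aff 0 1 0 Y η (by intro x; ring), plT_eq] at key
  have pos : ∀ u v w, Tri u v w → Z u ≠ Z v →
      0 < ∑ w, if Tri u v w then plK X Y Φ u v w else 0 := by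
    intro u v w hw hne
    rcases H2 u v w hw with h0 | ⟨p, q, hpq, hx, hneg, g1, g2, g0, hu, hv, hp', hq'⟩
    · exact absurd h0 hne
    · rw [sumw u v p q _ hpq hx]
      have hp : Tri u v p := (hx p).2 (Or.inl rfl)
      have hq : Tri u v q := (hx q).2 (Or.inr rfl)
      rw [plK_affine X Y Φ g1 g2 g0 0 u v p hu hv (by rw [hp']; ring) (hD _ _ _ hp),
        plK_affine X Y Φ g1 g2 g0 (Φ q - (g1 * X q + g2 * Y q + g0)) u v q hu hv
          (by ring) (hD _ _ _ hq)]
      have := sgn _ _ hneg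
      have h3 : 0 < (Φ q - (g1 * X q + g2 * Y q + g0)) / |plD X Y u v q| :=
        div_pos (by linarith) (abs_pos.2 (hD _ _ _ hq))
      have h4 : ∀ A B C E : ℝ, B + C = 0 → 0 < E → 0 < A * B + 0 / |plD X Y u v p| + (A * C + E) := by
        intro A B C E h1 h2
        have : A * B + A * C = 0 := by rw [← mul_add, h1, mul_zero]
        rw [zero_div]; linarith
      exact h4 _ _ _ _ this h3
  have nn : ∀ u v, 0 ≤ ((Z v - Z u) * (Z v - Z u)) *
      ∑ w, if Tri u v w then plK X Y Φ u v w else 0 := by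
    intro u v
    by_cases h0 : Z u = Z v
    · rw [h0]; simp
    · by_cases hw : ∃ w, Tri u v w
      · obtain ⟨w, hw⟩ := hw
        exact mul_nonneg (mul_self_nonneg _) (pos u v w hw h0).le
      · push Not at hw
        rw [noTri u v _ hw]; simp
  intro u v w hw
  by_contra hne
  have k2 := (Finset.sum_eq_zero_iff_of_nonneg
    (fun u _ => Finset.sum_nonneg fun v _ => nn u v)).1 (by linarith [key]) u (Finset.mem_univ u)
  have k3 := (Finset.sum_eq_zero_iff_of_nonneg (fun v _ => nn u v)).1 k2 v (Finset.mem_univ v)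
  have h5 : 0 < (Z v - Z u) * (Z v - Z u) := mul_self_pos.2 (sub_ne_zero.2 (Ne.symm hne))
  exact absurd k3 (mul_pos h5 (pos u v w hw hne)).ne'


/-- The cone over a simplicial polytope: vectors `w v`, `v ∈ V`, in a `(d+1)`-dimensional
space, such that every proper face of the generated cone is simplicial. -/
structure SC {ι W : Type*} [AddCommGroup W] [Module ℝ W] (d : ℕ) (V : Finset ι)
    (w : ι → W) : Prop where
  fr : Module.finrank ℝ W = d + 1
  span : Submodule.span ℝ (w '' (V : Set ι)) = ⊤
  indep : ∀ ℓ : Module.Dual ℝ W, ℓ ≠ 0 → (∀ v ∈ V, 0 ≤ ℓ (w v)) →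
    LinearIndependent ℝ (fun v : {v // v ∈ V.filter (fun v => ℓ (w v) = 0)} => w v)
  vert : ∀ v ∈ V, ∃ ℓ : Module.Dual ℝ W, ℓ ≠ 0 ∧ (∀ u ∈ V, 0 ≤ ℓ (w u)) ∧ ℓ (w v) = 0

/-- Faces. -/
def Fc {ι W : Type*} [AddCommGroup W] [Module ℝ W] (V : Finset ι) (w : ι → W)
    (s : Finset ι) : Prop :=
  s ⊆ V ∧ ∃ ℓ : Module.Dual ℝ W, ℓ ≠ 0 ∧ (∀ v ∈ V, 0 ≤ ℓ (w v)) ∧ ∀ v ∈ s, ℓ (w v) = 0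

/-- Facets. -/
def Ft {ι W : Type*} [AddCommGroup W] [Module ℝ W] (d : ℕ) (V : Finset ι) (w : ι → W)
    (s : Finset ι) : Prop := Fc V w s ∧ s.card = d

section SCsec
variable {ι W : Type*} [DecidableEq ι] [AddCommGroup W] [Module ℝ W] {d : ℕ} {V : Finset ι} {w : ι → W}

lemma Fc.mono {s t : Finset ι} (h : Fc V w t) (hst : s ⊆ t) : Fc V w s := by
  obtain ⟨h1, ℓ, h2, h3, h4⟩ := h
  exact ⟨hst.trans h1, ℓ, h2, h3, fun v hv => h4 v (hst hv)⟩

lemma SC.fd (h : SC d V w) : FiniteDimensional ℝ W :=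
  FiniteDimensional.of_finrank_pos (by rw [h.fr]; omega)

lemma SC.exz (h : SC d V w) {ℓ : Module.Dual ℝ W} (h0 : ℓ ≠ 0) : ∃ v ∈ V, ℓ (w v) ≠ 0 := by
  by_contra hc
  push Not at hc
  apply h0
  have : (⊤ : Submodule ℝ W) ≤ LinearMap.ker ℓ := by
    rw [← h.span, Submodule.span_le]
    rintro _ ⟨v, hv, rfl⟩
    exact hc v hv
  ext x
  exact this (Submodule.mem_top)

lemma SC.li (h : SC d V w) {s : Finset ι} (hs : Fc V w s) :
    LinearIndependent ℝ (fun v : {v // v ∈ s} => w v) := by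
  obtain ⟨h1, ℓ, h2, h3, h4⟩ := hs
  have := h.indep ℓ h2 h3
  exact this.comp (fun v : {v // v ∈ s} => (⟨v.1, by simp [h1 v.2, h4 v.1 v.2]⟩ :
    {v // v ∈ V.filter (fun v => ℓ (w v) = 0)})) (by
      intro a b hab
      exact Subtype.ext (Subtype.mk.inj hab))

lemma SC.li_option (h : SC d V w) {s : Finset ι} (hs : Fc V w s) {ℓ : Module.Dual ℝ W}
    (hℓ : ∀ v ∈ s, ℓ (w v) = 0) {z : W} (hz : ℓ z ≠ 0) :
    LinearIndependent ℝ (fun o : Option {v // v ∈ s} => o.elim z (fun v => w v)) := by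
  rw [linearIndependent_option]
  refine ⟨h.li hs, ?_⟩
  intro hmem
  apply hz
  have : Submodule.span ℝ (Set.range ((fun o : Option {v // v ∈ s} =>
      o.elim z (fun v => w v)) ∘ some)) ≤ LinearMap.ker ℓ := by
    rw [Submodule.span_le]
    rintro _ ⟨v, rfl⟩
    exact hℓ v.1 v.2
  exact this hmem

lemma SC.card_le (h : SC d V w) {s : Finset ι} (hs : Fc V w s) : s.card ≤ d := by
  have := h.fd
  obtain ⟨h1, ℓ, h2, h3, h4⟩ := id hs
  obtain ⟨z, hz, hzz⟩ := h.exz h2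
  have := (h.li_option hs h4 hzz).fintype_card_le_finrank
  rw [h.fr] at this
  simpa using this

lemma SC.basis (h : SC d V w) {F : Finset ι} (hF : Ft d V w F) {ℓ : Module.Dual ℝ W}
    (hℓ : ∀ v ∈ F, ℓ (w v) = 0) {z : W} (hz : ℓ z ≠ 0) :
    ∃ b : Module.Basis (Option {v // v ∈ F}) ℝ W, b none = z ∧ ∀ v, b (some v) = w v := by
  have := h.fd
  have hli := h.li_option hF.1 hℓ hz
  have hc : Fintype.card (Option {v // v ∈ F}) = Module.finrank ℝ W := by
    rw [h.fr]; simp [hF.2]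
  refine ⟨basisOfLinearIndependentOfCardEqFinrank hli hc, ?_, ?_⟩
  · simp
  · intro v; simp

lemma SC.pos_off (h : SC d V w) {F : Finset ι} (hF : Ft d V w F) {ℓ : Module.Dual ℝ W}
    (h0 : ℓ ≠ 0) (hn : ∀ v ∈ V, 0 ≤ ℓ (w v)) (hℓ : ∀ v ∈ F, ℓ (w v) = 0) {v : ι} (hv : v ∈ V)
    (hvF : v ∉ F) : 0 < ℓ (w v) := by
  rcases (hn v hv).lt_or_eq with h1 | h1
  · exact h1
  · exfalso
    have : Fc V w (insert v F) := ⟨Finset.insert_subset hv hF.1.1, ℓ, h0, hn, by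
      intro u hu
      rcases Finset.mem_insert.1 hu with rfl | hu
      · exact h1.symm
      · exact hℓ u hu⟩
    have := h.card_le this
    rw [Finset.card_insert_of_notMem hvF, hF.2] at this
    omega

lemma Ft.func {F : Finset ι} (h : SC d V w) (hF : Ft d V w F) : ∃ ℓ : Module.Dual ℝ W, ℓ ≠ 0 ∧
    (∀ v ∈ V, 0 ≤ ℓ (w v)) ∧ (∀ v ∈ F, ℓ (w v) = 0) ∧ ∀ v ∈ V, v ∉ F → 0 < ℓ (w v) := by
  obtain ⟨h1, ℓ, h2, h3, h4⟩ := hF.1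
  exact ⟨ℓ, h2, h3, h4, fun v hv hvF => h.pos_off hF h2 h3 h4 hv hvF⟩

lemma SC.ext0 (h : SC d V w) {F : Finset ι} (hF : Ft d V w F) {ℓ : Module.Dual ℝ W}
    (hℓ : ∀ v ∈ F, ℓ (w v) = 0) {z : W} (hz : ℓ z ≠ 0) {g : Module.Dual ℝ W}
    (hg : ∀ v ∈ F, g (w v) = 0) (hgz : g z = 0) : g = 0 := by
  obtain ⟨b, b1, b2⟩ := h.basis hF hℓ hz
  apply b.ext
  rintro (_ | v)
  · rw [b1, hgz]; rfl
  · rw [b2, hg v.1 v.2]; rfl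

lemma SC.ext1 (h : SC d V w) {F : Finset ι} (hF : Ft d V w F) {q : ι} (hq : q ∈ V) (hqF : q ∉ F)
    {g : Module.Dual ℝ W} (hg : ∀ v ∈ F, g (w v) = 0) (hgz : g (w q) = 0) : g = 0 := by
  obtain ⟨ℓ, h0, hn, hz, hp⟩ := Ft.func h hF
  exact h.ext0 hF hz (hp q hq hqF).ne' hg hgz

lemma SC.interp (h : SC d V w) {F : Finset ι} (hF : Ft d V w F) {q : ι} (hq : q ∈ V) (hqF : q ∉ F)
    (val : ι → ℝ) (t : ℝ) :
    ∃ g : Module.Dual ℝ W, g (w q) = t ∧ ∀ v ∈ F, g (w v) = val v := by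
  obtain ⟨ℓ, h0, hn, hz, hp⟩ := Ft.func h hF
  obtain ⟨b, b1, b2⟩ := h.basis hF hz (hp q hq hqF).ne'
  refine ⟨b.constr ℝ (fun o => o.elim t (fun v => val v)), ?_, ?_⟩
  · rw [← b1, b.constr_basis]; rfl
  · intro v hv
    have := b2 ⟨v, hv⟩
    simp only at this
    rw [← this, b.constr_basis]; rfl

lemma SC.off (h : SC d V w) {F : Finset ι} (hF : Ft d V w F) : ∃ q ∈ V, q ∉ F := by
  obtain ⟨ℓ, h0, hn, hz, hp⟩ := Ft.func h hF
  obtain ⟨z, hzV, hzz⟩ := h.exz h0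
  exact ⟨z, hzV, fun hF => hzz (hz z hF)⟩

/-- Rotation: minimise `g / ℓ`. -/
lemma rotate {ℓ g : Module.Dual ℝ W} (T : Finset ι) (hT : T.Nonempty)
    (hℓ : ∀ v ∈ T, 0 < ℓ (w v)) : ∃ t : ℝ, ∃ q ∈ T, (g - t • ℓ) (w q) = 0 ∧
      ∀ v ∈ T, 0 ≤ (g - t • ℓ) (w v) := by
  obtain ⟨q, hq, hmin⟩ := Finset.exists_min_image T (fun v => g (w v) / ℓ (w v)) hT
  refine ⟨g (w q) / ℓ (w q), q, hq, ?_, ?_⟩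
  · have := (hℓ q hq).ne'
    simp only [LinearMap.sub_apply, LinearMap.smul_apply, smul_eq_mul]
    field_simp
    ring
  · intro v hv
    have h1 := hmin v hv
    have h2 := hℓ v hv
    simp only [LinearMap.sub_apply, LinearMap.smul_apply, smul_eq_mul]
    rw [le_div_iff₀ h2] at h1
    linarith

lemma SC.extend_one (h : SC d V w) {s : Finset ι} (hs : Fc V w s) (hc : s.card < d) :
    ∃ v, v ∉ s ∧ Fc V w (insert v s) := by
  have := h.fd
  obtain ⟨hsV, ℓ, h0, hn, hz⟩ := id hs
  by_cases hex : ∃ v ∈ V, v ∉ s ∧ ℓ (w v) = 0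
  · obtain ⟨v, hv, hvs, hv0⟩ := hex
    refine ⟨v, hvs, Finset.insert_subset hv hsV, ℓ, h0, hn, ?_⟩
    intro u hu
    rcases Finset.mem_insert.1 hu with rfl | hu
    · exact hv0
    · exact hz u hu
  · push Not at hex
    obtain ⟨z, hzV, hzz⟩ := h.exz h0
    have hlt : Submodule.span ℝ (((insert z s).image w : Finset W) : Set W) < ⊤ := by
      rw [lt_top_iff_ne_top]
      intro htop
      have h1 := finrank_span_finset_le_card (R := ℝ) ((insert z s).image w)
      rw [Set.finrank, htop, finrank_top, h.fr] at h1
      have h2 := (Finset.card_image_le (s := insert z s) (f := w)).trans (Finset.card_insert_le z s)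
      omega
    obtain ⟨g, hg0, hg⟩ := Submodule.exists_le_ker_of_lt_top _ hlt
    have hgs : ∀ v ∈ insert z s, g (w v) = 0 := by
      intro v hv
      exact hg (Submodule.subset_span (by
        rw [Finset.coe_image]; exact ⟨v, by exact_mod_cast hv, rfl⟩))
    have hzs : z ∉ s := fun hh => hzz (hz z hh)
    obtain ⟨t, q, hq, hq0, hpos⟩ := rotate (w := w) (ℓ := ℓ) (g := g) (V \ s)
      ⟨z, by simp [hzV, hzs]⟩ (by
        intro v hv
        rw [Finset.mem_sdiff] at hv
        exact lt_of_le_of_ne (hn v hv.1) (Ne.symm (hex v hv.1 hv.2)))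
    rw [Finset.mem_sdiff] at hq
    have hss : ∀ v ∈ s, (g - t • ℓ) (w v) = 0 := by
      intro v hv
      simp [hgs v (Finset.mem_insert_of_mem hv), hz v hv]
    refine ⟨q, hq.2, Finset.insert_subset hq.1 hsV, g - t • ℓ, ?_, ?_, ?_⟩
    · intro hzero
      have h3 : (g - t • ℓ) (w z) = 0 := by rw [hzero]; rfl
      simp [hgs z (Finset.mem_insert_self _ _), hzz] at h3
      rw [h3] at hzero
      simp at hzero
      exact hg0 hzero
    · intro v hv
      by_cases hvs : v ∈ s
      · rw [hss v hvs]
      · exact hpos v (by simp [hv, hvs])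
    · intro v hv
      rcases Finset.mem_insert.1 hv with rfl | hv
      · exact hq0
      · exact hss v hv

lemma SC.extend (h : SC d V w) {s : Finset ι} (hs : Fc V w s) : ∃ F, s ⊆ F ∧ Ft d V w F := by
  have hle := h.card_le hs
  obtain ⟨k, hk⟩ := Nat.exists_eq_add_of_le hle
  induction k generalizing s with
  | zero => exact ⟨s, subset_rfl, hs, by omega⟩
  | succ k ih =>
    obtain ⟨v, hv, hvs⟩ := h.extend_one hs (by omega)
    have hc := Finset.card_insert_of_notMem hv
    obtain ⟨F, hF, hFt⟩ := ih hvs (h.card_le hvs) (by omega)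
    exact ⟨F, (Finset.subset_insert _ _).trans hF, hFt⟩

lemma SC.ridge (h : SC d V w) {R : Finset ι} {p : ι} (hp : p ∉ R) (hF : Ft d V w (insert p R)) :
    ∃ q ∈ V, q ∉ insert p R ∧ Ft d V w (insert q R) := by
  obtain ⟨ℓ, h0, hn, hz, hpos⟩ := Ft.func h hF
  obtain ⟨z, hzV, hzF⟩ := h.off hF
  obtain ⟨g, -, hg⟩ := h.interp hF hzV hzF (fun v => if v = p then 1 else 0) 0
  obtain ⟨t, q, hq, hq0, hge⟩ := rotate (w := w) (ℓ := ℓ) (g := g) (V \ insert p R)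
    ⟨z, by rw [Finset.mem_sdiff]; exact ⟨hzV, hzF⟩⟩ (by
      intro v hv
      rw [Finset.mem_sdiff] at hv
      exact hpos v hv.1 hv.2)
  rw [Finset.mem_sdiff] at hq
  have hR : ∀ v ∈ insert p R, (g - t • ℓ) (w v) = if v = p then 1 else 0 := by
    intro v hv
    simp [hg v hv, hz v hv]
  refine ⟨q, hq.1, hq.2, ⟨?_, g - t • ℓ, ?_, ?_, ?_⟩, ?_⟩
  · exact Finset.insert_subset hq.1 ((Finset.subset_insert _ _).trans hF.1.1)
  · intro hzero
    have := hR p (Finset.mem_insert_self _ _)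
    rw [hzero] at this
    simp at this
  · intro v hv
    by_cases hvF : v ∈ insert p R
    · rw [hR v hvF]; split_ifs <;> norm_num
    · exact hge v (by rw [Finset.mem_sdiff]; exact ⟨hv, hvF⟩)
  · intro v hv
    rcases Finset.mem_insert.1 hv with rfl | hv
    · exact hq0
    · rw [hR v (Finset.mem_insert_of_mem hv), if_neg]
      rintro rfl; exact hp hv
  · have h1 := hF.2
    rw [Finset.card_insert_of_notMem hp] at h1
    rw [Finset.card_insert_of_notMem (fun hh => hq.2 (Finset.mem_insert_of_mem hh)), h1]

lemma SC.ridge_unique (h : SC d V w) {R : Finset ι} {p q x : ι} (hp : p ∉ R) (hq : q ∉ R)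
    (hpq : p ≠ q) (hP : Ft d V w (insert p R)) (hQ : Ft d V w (insert q R)) (hx : x ∉ R)
    (hX : Ft d V w (insert x R)) : x = p ∨ x = q := by
  by_contra hc
  push Not at hc
  obtain ⟨hxp, hxq⟩ := hc
  have mV : ∀ y, Ft d V w (insert y R) → y ∈ V := fun y hy => hy.1.1 (Finset.mem_insert_self _ _)
  have ni : ∀ a b, a ≠ b → a ∉ R → a ∉ insert b R := by
    intro a b hab ha hm
    rcases Finset.mem_insert.1 hm with h1 | h1
    · exact hab h1
    · exact ha h1
  obtain ⟨ℓp, -, -, hzp, hpp⟩ := Ft.func h hP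
  obtain ⟨ℓq, -, -, hzq, hpq'⟩ := Ft.func h hQ
  obtain ⟨ℓx, -, -, hzx, hpx⟩ := Ft.func h hX
  have a1 := hpp q (mV q hQ) (ni q p hpq.symm hq)
  have a2 := hpq' p (mV p hP) (ni p q hpq hp)
  have a3 := hpx q (mV q hQ) (ni q x hxq.symm hq)
  have a4 := hpx p (mV p hP) (ni p x hxp.symm hp)
  have a5 := hpp x (mV x hX) (ni x p hxp hx)
  have a6 := hpq' x (mV x hX) (ni x q hxq hx)
  have hzero : ℓx - (ℓx (w q) / ℓp (w q)) • ℓp - (ℓx (w p) / ℓq (w p)) • ℓq = 0 := by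
    refine h.ext1 hP (mV q hQ) (ni q p hpq.symm hq) ?_ ?_
    · intro v hv
      rcases Finset.mem_insert.1 hv with rfl | hv
      · simp only [LinearMap.sub_apply, LinearMap.smul_apply, smul_eq_mul,
          hzp v (Finset.mem_insert_self _ _)]
        field_simp; ring
      · simp [hzx v (Finset.mem_insert_of_mem hv), hzp v (Finset.mem_insert_of_mem hv),
          hzq v (Finset.mem_insert_of_mem hv)]
    · simp only [LinearMap.sub_apply, LinearMap.smul_apply, smul_eq_mul,
          hzq q (Finset.mem_insert_self _ _)]
      field_simp; ring
  have := congrArg (fun g => g (w x)) hzero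
  simp only [LinearMap.sub_apply, LinearMap.smul_apply, smul_eq_mul, LinearMap.zero_apply,
    hzx x (Finset.mem_insert_self _ _)] at this
  have b1 := mul_pos (div_pos a3 a1) a5
  have b2 := mul_pos (div_pos a4 a2) a6
  linarith

lemma SC.exact (h : SC d V w) {s : Finset ι} (hs : Fc V w s) : ∃ ℓ : Module.Dual ℝ W,
    (∀ v ∈ s, ℓ (w v) = 0) ∧ ∀ v ∈ V, v ∉ s → 0 < ℓ (w v) := by
  obtain ⟨F, hsF, hF⟩ := h.extend hs
  obtain ⟨ℓ, h0, hn, hz, hpos⟩ := Ft.func h hF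
  obtain ⟨z, hzV, hzF⟩ := h.off hF
  obtain ⟨g, -, hg⟩ := h.interp hF hzV hzF (fun v => if v ∈ s then 0 else 1) 0
  refine ⟨g + (∑ v ∈ V, |g (w v)| / ℓ (w v) + 1) • ℓ, ?_, ?_⟩
  · intro v hv
    simp [hg v (hsF hv), hz v (hsF hv), hv]
  · intro v hv hvs
    by_cases hvF : v ∈ F
    · simp [hg v hvF, hz v hvF, hvs]
    · have h1 := hpos v hv hvF
      have h2 : |g (w v)| / ℓ (w v) ≤ ∑ v ∈ V, |g (w v)| / ℓ (w v) :=
        Finset.single_le_sum (f := fun v => |g (w v)| / ℓ (w v))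
          (fun u hu => div_nonneg (abs_nonneg _) (hn u hu)) hv
      rw [div_le_iff₀ h1] at h2
      have h3 := neg_abs_le (g (w v))
      simp only [LinearMap.add_apply, LinearMap.smul_apply, smul_eq_mul]
      nlinarith

lemma SC.conn (h : SC d V w) (ρ : Finset ι) (S : Finset ι → Prop) {F0 : Finset ι}
    (hF0 : Ft d V w F0) (hρ : ρ ⊆ F0) (hS : S F0)
    (hcl : ∀ R p q, p ∉ R → q ∉ R → p ≠ q → Ft d V w (insert p R) → Ft d V w (insert q R) →
      ρ ⊆ R → S (insert p R) → S (insert q R)) :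
    ∀ G, Ft d V w G → ρ ⊆ G → S G := by
  intro G hG hρG
  set o : W := ∑ v ∈ V, w v with ho
  have hopos : ∀ F, Ft d V w F → ∃ ℓ : Module.Dual ℝ W, (∀ v ∈ V, 0 ≤ ℓ (w v)) ∧
      (∀ v ∈ F, ℓ (w v) = 0) ∧ (∀ v ∈ V, v ∉ F → 0 < ℓ (w v)) ∧ ℓ o = 1 := by
    intro F hF
    obtain ⟨ℓ, h0, hn, hz, hpos⟩ := Ft.func h hF
    obtain ⟨z, hzV, hzF⟩ := h.off hF
    have hp : 0 < ℓ o := by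
      rw [ho, map_sum]
      exact Finset.sum_pos' hn ⟨z, hzV, hpos z hzV hzF⟩
    refine ⟨(ℓ o)⁻¹ • ℓ, ?_, ?_, ?_, ?_⟩
    · intro v hv
      exact mul_nonneg (inv_nonneg.2 hp.le) (hn v hv)
    · intro v hv
      simp [hz v hv]
    · intro v hv hvF
      exact mul_pos (inv_pos.2 hp) (hpos v hv hvF)
    · simp [hp.ne']
  choose! L L1 L2 L3 L4 using hopos
  set x : W := ∑ v ∈ G \ ρ, w v with hx
  obtain ⟨F, hFmem, hmin⟩ := Finset.exists_min_image
    (V.powerset.filter fun F => Ft d V w F ∧ ρ ⊆ F ∧ S F) (fun F => L F x)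
    ⟨F0, by simp only [Finset.mem_filter, Finset.mem_powerset]; exact ⟨hF0.1.1, hF0, hρ, hS⟩⟩
  simp only [Finset.mem_filter, Finset.mem_powerset] at hFmem hmin
  obtain ⟨hFV, hF, hρF, hSF⟩ := hFmem
  by_cases hGF : G ⊆ F
  · rw [Finset.eq_of_subset_of_card_le hGF (by rw [hF.2, hG.2])]
    exact hSF
  · exfalso
    have hψ : 0 < L F x := by
      obtain ⟨y, hyG, hyF⟩ := Finset.not_subset.1 hGF
      rw [hx, map_sum]
      refine Finset.sum_pos' (fun v hv => L1 F hF v (hG.1.1 (Finset.sdiff_subset hv))) ⟨y, ?_, ?_⟩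
      · rw [Finset.mem_sdiff]; exact ⟨hyG, fun hh => hyF (hρF hh)⟩
      · exact L3 F hF y (hG.1.1 hyG) hyF
    obtain ⟨b, b1, b2⟩ := h.basis hF (L2 F hF) (z := o) (by rw [L4 F hF]; norm_num)
    have hxe : ∀ ℓ : Module.Dual ℝ W, ℓ x = b.repr x none * ℓ o +
        ∑ v : {v // v ∈ F}, b.repr x (some v) * ℓ (w v) := by
      intro ℓ
      conv_lhs => rw [← b.sum_repr x]
      rw [map_sum, Fintype.sum_option]
      simp [b1, b2]
    have hnone : b.repr x none = L F x := by
      rw [hxe (L F), L4 F hF, Finset.sum_eq_zero]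
      · ring
      · intro v _
        rw [L2 F hF v.1 v.2, mul_zero]
    have hneg : ∃ v : {v // v ∈ F}, v.1 ∉ ρ ∧ b.repr x (some v) < 0 := by
      by_contra hc
      push Not at hc
      have h1 := hxe (L G)
      have h2 : L G x = 0 := by
        rw [hx, map_sum]
        exact Finset.sum_eq_zero fun v hv => L2 G hG v (Finset.sdiff_subset hv)
      have h3 : 0 ≤ ∑ v : {v // v ∈ F}, b.repr x (some v) * (L G) (w v) := by
        refine Finset.sum_nonneg fun v _ => ?_
        by_cases hv : v.1 ∈ ρ
        · rw [L2 G hG v.1 (hρG hv), mul_zero]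
        · exact mul_nonneg (hc v hv) (L1 G hG _ (hFV v.2))
      rw [h2, L4 G hG, hnone] at h1
      linarith
    obtain ⟨⟨v, hvF⟩, hvρ, hvneg⟩ := hneg
    have hins : insert v (F.erase v) = F := Finset.insert_erase hvF
    obtain ⟨q, hqV, hq, hFq⟩ := h.ridge (Finset.notMem_erase v F) (by rw [hins]; exact hF)
    rw [hins] at hq
    have hqR : q ∉ F.erase v := fun hh => hq (Finset.mem_of_mem_erase hh)
    have hqv : v ≠ q := by rintro rfl; exact hq hvF
    have hρR : ρ ⊆ F.erase v := fun y hy => Finset.mem_erase.2 ⟨by rintro rfl; exact hvρ hy, hρF hy⟩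
    have hSq := hcl (F.erase v) v q (Finset.notMem_erase v F) hqR hqv (by rw [hins]; exact hF) hFq
      hρR (by rw [hins]; exact hSF)
    have hm := hmin (insert q (F.erase v)) ⟨hFq.1.1, hFq,
      hρR.trans (Finset.subset_insert _ _), hSq⟩
    have h5 := hxe (L (insert q (F.erase v)))
    rw [L4 _ hFq, hnone, Finset.sum_eq_single (⟨v, hvF⟩ : {v // v ∈ F})] at h5
    · have h6 := L3 _ hFq v (hFV hvF) (by
        intro hh
        rcases Finset.mem_insert.1 hh with h7 | h7
        · exact hqv h7
        · exact Finset.notMem_erase v F h7)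
      have h8 := mul_neg_of_neg_of_pos hvneg h6
      simp only at h5
      linarith
    · intro u _ hu
      rw [L2 _ hFq u.1 (Finset.mem_insert_of_mem (Finset.mem_erase.2
        ⟨fun hh => hu (Subtype.ext hh), u.2⟩)), mul_zero]
    · intro hh; exact absurd (Finset.mem_univ _) hh

/-- Antisymmetric form extending a motion on a facet. -/
lemma SC.bex (h : SC d V w) {F : Finset ι} (hF : Ft d V w F) (m : ι → Module.Dual ℝ W)
    (hc : ∀ u ∈ F, ∀ v ∈ F, m u (w v) + m v (w u) = 0) :
    ∃ B : W →ₗ[ℝ] Module.Dual ℝ W, (∀ x y, B x y + B y x = 0) ∧ ∀ v ∈ F, B (w v) = m v := by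
  obtain ⟨z, hzV, hzF⟩ := h.off hF
  obtain ⟨ℓ, h0, hn, hz, hpos⟩ := Ft.func h hF
  obtain ⟨b, b1, b2⟩ := h.basis hF hz (hpos z hzV hzF).ne'
  let A : Option {v // v ∈ F} → Option {v // v ∈ F} → ℝ := fun i j =>
    match i, j with
    | none, none => 0
    | none, some v => - m v.1 (w z)
    | some v, none => m v.1 (w z)
    | some u, some v => m u.1 (w v.1)
  have hA : ∀ i j, A i j + A j i = 0 := by
    rintro (_ | u) (_ | v)
    · simp [A]
    · simp [A]
    · simp [A]
    · exact hc u.1 u.2 v.1 v.2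
  let B : W →ₗ[ℝ] Module.Dual ℝ W := b.constr ℝ (fun i => b.constr ℝ (fun j => A i j))
  have hB : ∀ i j, B (b i) (b j) = A i j := by
    intro i j
    simp [B]
  have hanti : B + B.flip = 0 := by
    apply b.ext
    intro i
    apply b.ext
    intro j
    simp [hB, hA]
  refine ⟨B, ?_, ?_⟩
  · intro x y
    have := congrArg (fun C : W →ₗ[ℝ] Module.Dual ℝ W => C x y) hanti
    simpa using this
  · intro v hv
    apply b.ext
    have e := b2 ⟨v, hv⟩
    simp only at e
    rintro (_ | u)
    · rw [← e, hB, b1]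
    · rw [← e, hB, b2]
end SCsec


lemma plD_ne_aux {e1 e2 f1 f2 a b a' b' : ℝ} (h1 : a * e1 + b * e2 = 0) (h2 : a * f1 + b * f2 ≠ 0)
    (h3 : a' * e1 + b' * e2 ≠ 0) : e1 * f2 - f1 * e2 ≠ 0 := by
  intro h
  have e1z : e1 * (a * f1 + b * f2) = 0 := by linear_combination b * h + f1 * h1
  have e2z : e2 * (a * f1 + b * f2) = 0 := by linear_combination (-a) * h + f2 * h1
  have e1z := (mul_eq_zero.1 e1z).resolve_right h2
  have e2z := (mul_eq_zero.1 e2z).resolve_right h2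
  apply h3
  rw [e1z, e2z]; ring

lemma plD_opp_aux {e1 e2 f1 f2 g1 g2 a b : ℝ} (h1 : a * e1 + b * e2 = 0)
    (h2 : 0 < a * f1 + b * f2) (h3 : a * g1 + b * g2 < 0) (hD : e1 * f2 - f1 * e2 ≠ 0) :
    (e1 * f2 - f1 * e2) * (e1 * g2 - g1 * e2) < 0 := by
  have key : (a * f1 + b * f2) * (a * g1 + b * g2) * (e1 ^ 2 + e2 ^ 2) =
      (a ^ 2 + b ^ 2) * ((e1 * f2 - f1 * e2) * (e1 * g2 - g1 * e2)) := by
    have a1 : (a * f1 + b * f2) * e1 = b * (e1 * f2 - f1 * e2) := by linear_combination f1 * h1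
    have a2 : (a * g1 + b * g2) * e1 = b * (e1 * g2 - g1 * e2) := by linear_combination g1 * h1
    have a3 : (a * f1 + b * f2) * e2 = -a * (e1 * f2 - f1 * e2) := by linear_combination f2 * h1
    have a4 : (a * g1 + b * g2) * e2 = -a * (e1 * g2 - g1 * e2) := by linear_combination g2 * h1
    calc _ = ((a * f1 + b * f2) * e1) * ((a * g1 + b * g2) * e1) +
        ((a * f1 + b * f2) * e2) * ((a * g1 + b * g2) * e2) := by ring
      _ = _ := by rw [a1, a2, a3, a4]; ring
  have he : 0 < e1 ^ 2 + e2 ^ 2 := by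
    by_contra hn
    have hn := not_lt.1 hn
    have z1 : e1 = 0 := by nlinarith [sq_nonneg e1, sq_nonneg e2]
    have z2 : e2 = 0 := by nlinarith [sq_nonneg e1, sq_nonneg e2]
    apply hD; rw [z1, z2]; ring
  have hlt : (a ^ 2 + b ^ 2) * ((e1 * f2 - f1 * e2) * (e1 * g2 - g1 * e2)) < 0 := by
    rw [← key]
    exact mul_neg_of_neg_of_pos (mul_neg_of_pos_of_neg h2 h3) he
  by_contra hn
  have := mul_nonneg (by positivity : 0 ≤ a ^ 2 + b ^ 2) (not_lt.1 hn)
  linarith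

section SCsec2
variable {ι W : Type*} [DecidableEq ι] [AddCommGroup W] [Module ℝ W] {d : ℕ} {V : Finset ι} {w : ι → W}

set_option maxHeartbeats 2000000 in
/-- Core of the local rigidity theorem, normalised motion. -/
lemma SC.core (h : SC d V w) {τ : Finset ι} {u0 v0 p q : ι}
    (hu0 : u0 ∉ τ) (hv0 : v0 ∉ τ) (huv : u0 ≠ v0) (hp : p ∉ insert u0 (insert v0 τ))
    (hq : q ∉ insert u0 (insert v0 τ)) (hpq : p ≠ q)
    (hP : Ft d V w (insert p (insert u0 (insert v0 τ))))
    (hQ : Ft d V w (insert q (insert u0 (insert v0 τ))))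
    (m : ι → Module.Dual ℝ W)
    (hc : ∀ u v, Fc V w (insert u (insert v τ)) → m u (w v) + m v (w u) = 0)
    (h0 : ∀ v ∈ insert q (insert u0 (insert v0 τ)), m v = 0) : m p (w q) = 0 := by
  have hqτ : q ∉ τ := fun hh => hq (by simp [hh])
  have hpτ : p ∉ τ := fun hh => hp (by simp [hh])
  have hpV : p ∈ V := hP.1.1 (by simp)
  have hqV : q ∈ V := hQ.1.1 (by simp)
  have hpu : p ≠ u0 := fun hh => hp (by simp [hh])
  have hpv : p ≠ v0 := fun hh => hp (by simp [hh])
  have hqu : q ≠ u0 := fun hh => hq (by simp [hh])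
  have hqv : q ≠ v0 := fun hh => hq (by simp [hh])
  have hpF : p ∉ insert q (insert u0 (insert v0 τ)) := by
    rw [Finset.mem_insert]; rintro (hh | hh)
    · exact hpq hh
    · exact hp hh
  have hρ : Fc V w (insert q τ) := hQ.1.mono (by intro x hx; simp at hx ⊢; tauto)
  obtain ⟨lam, l0, lpos⟩ := h.exact hρ
  obtain ⟨κ1, k1p, k1⟩ := h.interp hQ hpV hpF (fun v => if v = u0 then 1 else 0) 0
  obtain ⟨κ2, k2p, k2⟩ := h.interp hQ hpV hpF (fun v => if v = v0 then 1 else 0) 0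
  obtain ⟨φ, fp, fF⟩ := h.interp hQ hpV hpF (fun v => if v = q then 1 else 0) 0
  have lpp : 0 < lam (w p) := lpos p hpV (by simp [hpq, hpτ])
  have ann : ∀ g : Module.Dual ℝ W, g (w q) = 0 → (∀ t ∈ τ, g (w t) = 0) →
      ∃ a b c : ℝ, ∀ x, g x = a * κ1 x + b * κ2 x + c * lam x := by
    intro g gq gt
    set c := g (w p) / lam (w p) with hcdef
    set a := g (w u0) - c * lam (w u0)
    set b := g (w v0) - c * lam (w v0)
    refine ⟨a, b, c, ?_⟩
    have : g - (a • κ1 + b • κ2 + c • lam) = 0 := by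
      apply h.ext1 hQ hpV hpF
      · intro v hv
        have e1 := k1 v hv
        have e2 := k2 v hv
        simp only [Finset.mem_insert] at hv
        simp only [LinearMap.sub_apply, LinearMap.add_apply, LinearMap.smul_apply, smul_eq_mul, e1, e2]
        rcases hv with rfl | rfl | rfl | hv
        · simp [hqu, hqv, gq, l0 v (by simp)]
        · simp [huv, a]
        · simp [huv.symm, b]
        · have : v ≠ u0 := fun hh => hu0 (hh ▸ hv)
          have : v ≠ v0 := fun hh => hv0 (hh ▸ hv)
          simp [*, gt v hv, l0 v (by simp [hv])]
      · simp only [LinearMap.sub_apply, LinearMap.add_apply, LinearMap.smul_apply, smul_eq_mul, k1p, k2p, hcdef]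
        field_simp
        ring
    intro x
    have := congrArg (fun g => g x) this
    simp only [LinearMap.sub_apply, LinearMap.add_apply, LinearMap.smul_apply, smul_eq_mul, LinearMap.zero_apply] at this
    linarith
  have fq : φ (w q) = 1 := by rw [fF q (by simp)]; simp
  have ft : ∀ t ∈ τ, φ (w t) = 0 := by
    intro t ht
    rw [fF t (by simp [ht])]
    simp [show t ≠ q from fun hh => hqτ (hh ▸ ht)]
  -- coordinates of the motion
  have hm : ∀ v, ∃ a b c : ℝ, Fc V w (insert v τ) →
      ∀ x, m v x = m v (w q) * φ x + (a * κ1 x + b * κ2 x + c * lam x) := by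
    intro v
    by_cases hv : Fc V w (insert v τ)
    · obtain ⟨a, b, c, habc⟩ := ann (m v - m v (w q) • φ) (by simp [fq]) (by
        intro t ht
        have h1 := hc v t (by rwa [Finset.insert_eq_of_mem ht])
        rw [h0 t (by simp [ht])] at h1
        simp [ft t ht]
        simpa using h1)
      refine ⟨a, b, c, fun _ x => ?_⟩
      rw [← habc]; simp
    · exact ⟨0, 0, 0, fun hh => absurd hh hv⟩
  choose ma mb mc hm using hm
  -- triangles
  let Tri : {x // x ∈ V} → {x // x ∈ V} → {x // x ∈ V} → Prop := fun u v x =>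
    (u.1 ≠ v.1 ∧ v.1 ≠ x.1 ∧ u.1 ≠ x.1) ∧ (u.1 ∉ τ ∧ v.1 ∉ τ ∧ x.1 ∉ τ) ∧
      (u.1 ≠ q ∧ v.1 ≠ q ∧ x.1 ≠ q) ∧ Ft d V w (insert x.1 (insert u.1 (insert v.1 τ)))
  have hcyc : ∀ u v x, Tri u v x → Tri v x u := by
    rintro u v x ⟨⟨a1, a2, a3⟩, ⟨b1, b2, b3⟩, ⟨c1, c2, c3⟩, hF⟩
    refine ⟨⟨a2, a3.symm, a1.symm⟩, ⟨b2, b3, b1⟩, ⟨c2, c3, c1⟩, ?_⟩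
    convert hF using 1
    ext y; simp only [Finset.mem_insert]; tauto
  let X : {x // x ∈ V} → ℝ := fun v => κ1 (w v) / lam (w v)
  let Y : {x // x ∈ V} → ℝ := fun v => κ2 (w v) / lam (w v)
  let Φ : {x // x ∈ V} → ℝ := fun v => φ (w v) / lam (w v)
  let Z : {x // x ∈ V} → ℝ := fun v => m v (w q) / lam (w v)
  let ξ : {x // x ∈ V} → ℝ := fun v => ma v / lam (w v)
  let η : {x // x ∈ V} → ℝ := fun v => mb v / lam (w v)
  have lp : ∀ u : {x // x ∈ V}, u.1 ∉ τ → u.1 ≠ q → 0 < lam (w u) := by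
    intro u h1 h2
    exact lpos u.1 u.2 (by simp [h1, h2])
  have aff : ∀ (u : {x // x ∈ V}), u.1 ∉ τ → u.1 ≠ q → ∀ (g : Module.Dual ℝ W) (a b c : ℝ),
      (∀ x, g x = a * κ1 x + b * κ2 x + c * lam x) →
      a * X u + b * Y u + c = g (w u) / lam (w u) := by
    intro u h1 h2 g a b c hg
    have := (lp u h1 h2).ne'
    rw [hg]; simp only [X, Y]; field_simp
  -- dual functionals of a triangle
  have dual : ∀ u v x, Tri u v x → ∃ a b c : ℝ, a * X u + b * Y u + c = 0 ∧
      a * X v + b * Y v + c = 0 ∧ a * X x + b * Y x + c ≠ 0 := by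
    rintro u v x ⟨⟨a1, a2, a3⟩, ⟨b1, b2, b3⟩, ⟨c1, c2, c3⟩, hF⟩
    obtain ⟨g, gq, gF⟩ := h.interp hF hqV (by simp [c1.symm, c2.symm, c3.symm, hqτ])
      (fun y => if y = x.1 then 1 else 0) 0
    obtain ⟨a, b, c, habc⟩ := ann g gq (by
      intro t ht
      rw [gF t (by simp [ht])]
      simp [show t ≠ x.1 from fun hh => b3 (hh ▸ ht)])
    refine ⟨a, b, c, ?_, ?_, ?_⟩
    · rw [aff u b1 c1 g a b c habc, gF u.1 (by simp)]; simp [a3]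
    · rw [aff v b2 c2 g a b c habc, gF v.1 (by simp)]; simp [a2]
    · rw [aff x b3 c3 g a b c habc, gF x.1 (by simp)]; simp [(lp x b3 c3).ne']
  have hD : ∀ u v x, Tri u v x → plD X Y u v x ≠ 0 := by
    intro u v x ht
    obtain ⟨a, b, c, e1, e2, e3⟩ := dual u v x ht
    obtain ⟨a', b', c', e1', e2', e3'⟩ := dual x u v (hcyc _ _ _ (hcyc _ _ _ ht))
    refine plD_ne_aux (a := a) (b := b) (a' := a') (b' := b') ?_ ?_ ?_
    · linarith
    · intro hh; apply e3; linarith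
    · intro hh; apply e3'; linarith
  have H1 : ∀ u v x, Tri u v x → (X v - X u) * (ξ v - ξ u) + (Y v - Y u) * (η v - η u)
      + (Φ v - Φ u) * (Z v - Z u) = 0 := by
    rintro u v x ⟨⟨a1, a2, a3⟩, ⟨b1, b2, b3⟩, ⟨c1, c2, c3⟩, hF⟩
    have fuv : Fc V w (insert u.1 (insert v.1 τ)) := hF.1.mono (by
      intro y hy; simp at hy ⊢; tauto)
    have fu : Fc V w (insert u.1 τ) := fuv.mono (by intro y hy; simp at hy ⊢; tauto)
    have fv : Fc V w (insert v.1 τ) := fuv.mono (by intro y hy; simp at hy ⊢; tauto)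
    have cuu := hc u.1 u.1 (by simpa using fu)
    have cvv := hc v.1 v.1 (by simpa using fv)
    have cuv := hc u.1 v.1 fuv
    have lu := (lp u b1 c1).ne'
    have lv := (lp v b2 c2).ne'
    rw [hm u.1 fu] at cuu
    rw [hm v.1 fv] at cvv
    rw [hm u.1 fu, hm v.1 fv] at cuv
    have A1 : Z u * Φ u + ξ u * X u + η u * Y u + mc u / lam (w u) = 0 := by
      simp only [Z, Φ, ξ, X, η, Y]; field_simp; linarith
    have A2 : Z v * Φ v + ξ v * X v + η v * Y v + mc v / lam (w v) = 0 := by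
      simp only [Z, Φ, ξ, X, η, Y]; field_simp; linarith
    have A3 : Z u * Φ v + ξ u * X v + η u * Y v + mc u / lam (w u) +
        (Z v * Φ u + ξ v * X u + η v * Y u + mc v / lam (w v)) = 0 := by
      simp only [Z, Φ, ξ, X, η, Y]; field_simp; linarith
    linear_combination A1 + A2 - A3
  have H2 : ∀ u v x, Tri u v x → Z u = Z v ∨ ∃ p q, p ≠ q ∧ (∀ x, Tri u v x ↔ x = p ∨ x = q) ∧
      plD X Y u v p * plD X Y u v q < 0 ∧ ∃ g1 g2 g0 : ℝ, Φ u = g1 * X u + g2 * Y u + g0 ∧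
        Φ v = g1 * X v + g2 * Y v + g0 ∧ Φ p = g1 * X p + g2 * Y p + g0 ∧
        g1 * X q + g2 * Y q + g0 < Φ q := by
    intro u v x ht
    obtain ⟨⟨a1, a2, a3⟩, ⟨b1, b2, b3⟩, ⟨c1, c2, c3⟩, hF⟩ := id ht
    have hxR : x.1 ∉ insert u.1 (insert v.1 τ) := by simp [a3.symm, a2.symm, b3]
    obtain ⟨y, hyV, hyF, hY⟩ := h.ridge hxR hF
    have hyx : y ≠ x.1 := fun hh => hyF (by simp [hh])
    have hyR : y ∉ insert u.1 (insert v.1 τ) := fun hh => hyF (Finset.mem_insert_of_mem hh)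
    have hyu : y ≠ u.1 := fun hh => hyR (by simp [hh])
    have hyv : y ≠ v.1 := fun hh => hyR (by simp [hh])
    have hyτ : y ∉ τ := fun hh => hyR (by simp [hh])
    by_cases hyq : y = q
    · left
      subst hyq
      have zz : ∀ s ∈ insert u.1 (insert v.1 τ), m s (w y) = 0 := by
        intro s hs
        have := hc s y (hY.1.mono (by
          intro z hz; simp at hz hs ⊢; rcases hz with rfl | rfl | hz <;> tauto))
        rw [h0 y (by simp)] at this
        simpa using this
      simp only [Z]
      rw [zz u.1 (by simp), zz v.1 (by simp)]; simp
    · right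
      have hty : Tri u v ⟨y, hyV⟩ := ⟨⟨a1, hyv.symm, hyu.symm⟩, ⟨b1, b2, hyτ⟩, ⟨c1, c2, hyq⟩, hY⟩
      refine ⟨x, ⟨y, hyV⟩, fun hh => hyx (by rw [hh]), ?_, ?_, ?_⟩
      · intro z
        constructor
        · rintro ⟨⟨a1', a2', a3'⟩, ⟨b1', b2', b3'⟩, ⟨c1', c2', c3'⟩, hF'⟩
          have := h.ridge_unique hxR hyR hyx.symm hF hY (x := z.1)
            (by simp [a3'.symm, a2'.symm, b3']) hF'
          rcases this with hh | hh
          · left; exact Subtype.ext hh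
          · right; exact Subtype.ext hh
        · rintro (rfl | rfl)
          · exact ht
          · exact hty
      · -- opposite sides
        obtain ⟨f1, f1n, f1nn, f1z, f1p⟩ := Ft.func h hF
        obtain ⟨f2, f2n, f2nn, f2z, f2p⟩ := Ft.func h hY
        have q1 : 0 < f1 (w q) := f1p q hqV (by simp [c1.symm, c2.symm, c3.symm, hqτ])
        have q2 : 0 < f2 (w q) := f2p q hqV (by simp [Ne.symm hyq, c1.symm, c2.symm, hqτ])
        obtain ⟨a, b, c, habc⟩ := ann (f1 (w q) • f2 - f2 (w q) • f1) (by
            simp only [LinearMap.sub_apply, LinearMap.smul_apply, smul_eq_mul]; ring) (by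
          intro t ht
          simp [f1z t (by simp [ht]), f2z t (by simp [ht])])
        have eu := aff u b1 c1 _ a b c habc
        have ev := aff v b2 c2 _ a b c habc
        have ex := aff x b3 c3 _ a b c habc
        have ey := aff ⟨y, hyV⟩ hyτ hyq _ a b c habc
        simp only [LinearMap.sub_apply, LinearMap.smul_apply, smul_eq_mul] at eu ev ex ey
        rw [f1z u.1 (by simp), f2z u.1 (by simp)] at eu
        rw [f1z v.1 (by simp), f2z v.1 (by simp)] at ev
        rw [f1z x.1 (by simp)] at ex
        rw [f2z y (by simp)] at ey
        have px : 0 < f2 (w x) := f2p x.1 x.2 (by simp [hyx.symm, a3.symm, a2.symm, b3])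
        have py : 0 < f1 (w y) := f1p y hyV hyF
        have sx : 0 < (f1 (w q) * f2 (w x) - f2 (w q) * 0) / lam (w x) := by
          apply div_pos _ (lp x b3 c3)
          have := mul_pos q1 px
          linarith
        have sy : (f1 (w q) * 0 - f2 (w q) * f1 (w y)) / lam (w y) < 0 := by
          apply div_neg_of_neg_of_pos _ (lp ⟨y, hyV⟩ hyτ hyq)
          have := mul_pos q2 py
          linarith
        simp only [mul_zero, sub_zero, zero_div, zero_sub] at eu ev ex ey sx sy
        refine plD_opp_aux (a := a) (b := b) ?_ ?_ ?_ (hD _ _ _ ht)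
        · linarith
        · linarith
        · linarith
      · obtain ⟨f1, f1n, f1nn, f1z, f1p⟩ := Ft.func h hF
        have q1 : 0 < f1 (w q) := f1p q hqV (by simp [c1.symm, c2.symm, c3.symm, hqτ])
        obtain ⟨a, b, c, habc⟩ := ann (φ - (f1 (w q))⁻¹ • f1) (by
            simp only [LinearMap.sub_apply, LinearMap.smul_apply, smul_eq_mul, fq]
            field_simp; ring) (by
          intro t ht
          simp [f1z t (by simp [ht]), ft t ht])
        have eu := aff u b1 c1 _ a b c habc
        have ev := aff v b2 c2 _ a b c habc
        have ex := aff x b3 c3 _ a b c habc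
        have ey := aff ⟨y, hyV⟩ hyτ hyq _ a b c habc
        simp only [LinearMap.sub_apply, LinearMap.smul_apply, smul_eq_mul] at eu ev ex ey
        rw [f1z u.1 (by simp)] at eu
        rw [f1z v.1 (by simp)] at ev
        rw [f1z x.1 (by simp)] at ex
        have py : 0 < f1 (w y) := f1p y hyV hyF
        refine ⟨a, b, c, ?_, ?_, ?_, ?_⟩
        · rw [eu]; simp [Φ]
        · rw [ev]; simp [Φ]
        · rw [ex]; simp [Φ]
        · rw [ey]; simp only [Φ]
          have := lp ⟨y, hyV⟩ hyτ hyq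
          apply div_lt_div_of_pos_right _ this
          have := mul_pos (inv_pos.2 q1) py
          linarith
  have hu0V : u0 ∈ V := hP.1.1 (by simp)
  have hv0V : v0 ∈ V := hP.1.1 (by simp)
  have key := planar_energy Tri hcyc X Y Φ Z ξ η hD H1 H2 ⟨p, hpV⟩ ⟨u0, hu0V⟩ ⟨v0, hv0V⟩
    ⟨⟨hpu, huv, hpv⟩, ⟨hpτ, hu0, hv0⟩, ⟨hpq, hqu.symm, hqv.symm⟩, by
      convert hP using 1
      ext y; simp only [Finset.mem_insert]; tauto⟩
  simp only [Z] at key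
  rw [h0 u0 (by simp)] at key
  simp only [LinearMap.zero_apply, zero_div] at key
  exact (div_eq_zero_iff.1 key).resolve_right lpp.ne'

/-- Local rigidity theorem. -/
lemma SC.thmA (h : SC d V w) {R τ : Finset ι} {p q : ι} (hp : p ∉ R) (hq : q ∉ R) (hpq : p ≠ q)
    (hP : Ft d V w (insert p R)) (hQ : Ft d V w (insert q R)) (hτ : τ ⊆ R) (hd : 3 ≤ d)
    (hτc : τ.card = d - 3) (m : ι → Module.Dual ℝ W)
    (hc : ∀ u v, Fc V w (insert u (insert v τ)) → m u (w v) + m v (w u) = 0) :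
    m p (w q) + m q (w p) = 0 := by
  have hRc : R.card = d - 1 := by
    have := hP.2
    rw [Finset.card_insert_of_notMem hp] at this; omega
  have h2 : (R \ τ).card = 2 := by
    rw [Finset.card_sdiff_of_subset hτ]; omega
  obtain ⟨u0, v0, huv, he⟩ := Finset.card_eq_two.1 h2
  have hu0 : u0 ∈ R \ τ := by rw [he]; simp
  have hv0 : v0 ∈ R \ τ := by rw [he]; simp
  rw [Finset.mem_sdiff] at hu0 hv0
  have hR : R = insert u0 (insert v0 τ) := by
    rw [← Finset.sdiff_union_of_subset hτ, he]
    ext y; simp only [Finset.mem_insert, Finset.mem_union, Finset.mem_singleton]; tauto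
  subst hR
  obtain ⟨B, Ba, Bm⟩ := h.bex hQ m (by
    intro u hu v hv
    apply hc
    apply hQ.1.mono
    intro y hy
    simp only [Finset.mem_insert] at hy hu hv ⊢
    rcases hy with rfl | rfl | hy
    · exact hu
    · exact hv
    · tauto)
  have := h.core hu0.2 hv0.2 huv hp hq hpq hP hQ (fun v => m v - B (w v)) (by
    intro u v huv
    have := hc u v huv
    have := Ba (w u) (w v)
    simp only [LinearMap.sub_apply]
    linarith) (by
    intro v hv
    simp [Bm v hv])
  have e1 := Ba (w p) (w q)
  have e2 := Bm q (by simp)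
  simp only [LinearMap.sub_apply] at this
  rw [← e2]
  linarith

/-- Star rigidity. -/
lemma SC.star (h : SC d V w) (hd : 3 ≤ d) {ρ : Finset ι} (hρ : Fc V w ρ) (hρc : ρ.card ≤ d - 3)
    (m : ι → Module.Dual ℝ W)
    (hc : ∀ u v, Fc V w (insert u (insert v ρ)) → m u (w v) + m v (w u) = 0) :
    ∃ B : W →ₗ[ℝ] Module.Dual ℝ W, (∀ x y, B x y + B y x = 0) ∧
      ∀ v, Fc V w (insert v ρ) → m v = B (w v) := by
  obtain ⟨F0, hF0, hFt⟩ := h.extend hρ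
  have hcF : ∀ F, Ft d V w F → ρ ⊆ F → ∀ u ∈ F, ∀ v ∈ F, m u (w v) + m v (w u) = 0 := by
    intro F hF hρF u hu v hv
    apply hc
    apply hF.1.mono
    intro y hy
    simp only [Finset.mem_insert] at hy
    rcases hy with rfl | rfl | hy
    · exact hu
    · exact hv
    · exact hρF hy
  obtain ⟨B, Ba, Bm⟩ := h.bex hFt m (hcF F0 hFt hF0)
  refine ⟨B, Ba, ?_⟩
  have key : ∀ G, Ft d V w G → ρ ⊆ G → ∀ v ∈ G, m v = B (w v) := by
    apply h.conn ρ (fun F => ∀ v ∈ F, m v = B (w v)) hFt hF0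
    · intro v hv; exact (Bm v hv).symm
    · intro R p q hp hq hpq hP hQ hρR hS v hv
      rw [Finset.mem_insert] at hv
      rcases hv with rfl | hv
      · have hRc : R.card = d - 1 := by
          have := hP.2
          rw [Finset.card_insert_of_notMem hp] at this; omega
        obtain ⟨τ, h1, h2, h3⟩ := Finset.exists_subsuperset_card_eq hρR hρc (by omega)
        have hA := h.thmA hp hq hpq hP hQ h2 hd h3 m (by
          intro u v huv
          apply hc
          apply huv.mono
          intro y hy
          simp only [Finset.mem_insert] at hy ⊢
          rcases hy with rfl | rfl | hy
          · simp
          · simp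
          · right; right; exact h1 hy)
        have : m v - B (w v) = 0 := by
          apply h.ext1 hP (hQ.1.1 (by simp)) (q := v) (by
            rw [Finset.mem_insert]; rintro (hh | hh)
            · exact hpq hh.symm
            · exact hq hh)
          · intro u hu
            have e1 := Ba (w v) (w u)
            have e2 := hS u hu
            have e3 : m v (w u) + m u (w v) = 0 := by
              rw [Finset.mem_insert] at hu
              rcases hu with rfl | hu
              · linarith
              · exact hcF _ hQ (hρR.trans (Finset.subset_insert _ _)) v (by simp) u (by simp [hu])
            rw [e2] at e3
            simp only [LinearMap.sub_apply]
            linarith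
          · have e1 := Ba (w v) (w v)
            have e3 := hcF _ hQ (hρR.trans (Finset.subset_insert _ _)) v (by simp) v (by simp)
            simp only [LinearMap.sub_apply]
            linarith
        exact sub_eq_zero.1 this
      · exact hS v (by simp [hv])
  intro v hv
  obtain ⟨F, h1, h2⟩ := h.extend hv
  exact key F h2 ((Finset.subset_insert _ _).trans h1) v (h1 (by simp))
end SCsec2


/-- Homogenisation of a point. -/
def hw {d : ℕ} (v : Fin d → ℝ) : (Fin d → ℝ) × ℝ := (v, 1)

/-- The functional `c t - f x`. -/
def mkl {d : ℕ} (f : (Fin d → ℝ) →ₗ[ℝ] ℝ) (c : ℝ) : Module.Dual ℝ ((Fin d → ℝ) × ℝ) :=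
  c • LinearMap.snd ℝ (Fin d → ℝ) ℝ - f.comp (LinearMap.fst ℝ (Fin d → ℝ) ℝ)

lemma mkl_apply {d : ℕ} (f : (Fin d → ℝ) →ₗ[ℝ] ℝ) (c : ℝ) (x : Fin d → ℝ) (t : ℝ) :
    mkl f c (x, t) = c * t - f x := by simp [mkl]

lemma mkl_hw {d : ℕ} (f : (Fin d → ℝ) →ₗ[ℝ] ℝ) (c : ℝ) (x : Fin d → ℝ) :
    mkl f c (hw x) = c - f x := by rw [hw, mkl_apply, mul_one]

lemma exists_mkl {d : ℕ} (ℓ : Module.Dual ℝ ((Fin d → ℝ) × ℝ)) : ∃ f c, ℓ = mkl f c := by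
  refine ⟨-(ℓ.comp (LinearMap.inl ℝ (Fin d → ℝ) ℝ)), ℓ (0, 1), ?_⟩
  ext x
  · simp [mkl]
  · simp [mkl, show ((0 : Fin d → ℝ), (0 : ℝ)) = 0 from rfl]

lemma mkl_zero {d : ℕ} : mkl (0 : (Fin d → ℝ) →ₗ[ℝ] ℝ) 0 = 0 := by
  simp [mkl]

lemma mkl_eq_zero {d : ℕ} {f : (Fin d → ℝ) →ₗ[ℝ] ℝ} {c : ℝ} (h : mkl f c = 0) :
    f = 0 ∧ c = 0 := by
  have h1 : ∀ x t, c * t - f x = 0 := fun x t => by rw [← mkl_apply, h]; rfl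
  have hc : c = 0 := by simpa using h1 0 1
  refine ⟨?_, hc⟩
  apply LinearMap.ext
  intro x
  have := h1 x 0
  simp only [mul_zero, zero_sub, neg_eq_zero] at this
  exact this

lemma body_le {d : ℕ} {V : Finset (Fin d → ℝ)} {f : (Fin d → ℝ) →ₗ[ℝ] ℝ} {c : ℝ}
    (h : ∀ v ∈ V, f v ≤ c) : ∀ y ∈ polyBody V, f y ≤ c := by
  intro y hy
  have : polyBody V ⊆ {x | f x ≤ c} :=
    convexHull_min (fun v hv => h v hv) (convex_halfSpace_le f.isLinear c)
  exact this hy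

lemma mem_body {d : ℕ} {V : Finset (Fin d → ℝ)} {v : Fin d → ℝ} (h : v ∈ V) : v ∈ polyBody V :=
  subset_convexHull ℝ _ h

lemma aff_const {d : ℕ} {S : Set (Fin d → ℝ)} {f : (Fin d → ℝ) →ₗ[ℝ] ℝ} {c : ℝ}
    (h : ∀ v ∈ S, f v = c) : ∀ x ∈ affineSpan ℝ S, f x = c := by
  let A : AffineSubspace ℝ (Fin d → ℝ) :=
    { carrier := {x | f x = c}
      smul_vsub_vadd_mem' := by
        intro t a b e ha hb he
        simp only [Set.mem_setOf_eq] at *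
        simp [ha, hb, he] }
  have : affineSpan ℝ S ≤ A := affineSpan_le.2 (fun v hv => h v hv)
  intro x hx
  exact this hx

lemma SPolytope.const_zero {d : ℕ} (P : SPolytope d) {f : (Fin d → ℝ) →ₗ[ℝ] ℝ} {c : ℝ}
    (h : ∀ v ∈ P.V, f v = c) : f = 0 ∧ c = 0 := by
  have h1 : ∀ x, f x = c := fun x => aff_const (S := (P.V : Set _)) h x (by rw [P.span_top]; trivial)
  have hc : c = 0 := by rw [← h1 0, map_zero]
  refine ⟨?_, hc⟩
  apply LinearMap.ext
  intro x; rw [h1, hc]; rfl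

lemma linInd_hw {d : ℕ} {κ : Type*} {p : κ → Fin d → ℝ} (h : AffineIndependent ℝ p) :
    LinearIndependent ℝ (fun i => hw (p i)) := by
  rw [linearIndependent_iff']
  intro s g hg i hi
  rw [affineIndependent_iff] at h
  have h1 : ∑ i ∈ s, g i • p i = 0 := by
    have := congrArg Prod.fst hg
    simpa [hw, Prod.fst_sum] using this
  have h2 : ∑ i ∈ s, g i = 0 := by
    have := congrArg Prod.snd hg
    simpa [hw, Prod.snd_sum] using this
  exact h s g h2 h1 i hi

lemma affInd_of_hw {d : ℕ} {κ : Type*} {p : κ → Fin d → ℝ}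
    (h : LinearIndependent ℝ (fun i => hw (p i))) : AffineIndependent ℝ p := by
  rw [affineIndependent_iff]
  rw [linearIndependent_iff'] at h
  intro s g h1 h2 i hi
  refine h s g ?_ i hi
  apply Prod.ext
  · simpa [hw, Prod.fst_sum] using h2
  · simpa [hw, Prod.snd_sum] using h1

/-- The face of `f ≤ c`. -/
lemma SPolytope.face_of {d : ℕ} (P : SPolytope d) {f : (Fin d → ℝ) →ₗ[ℝ] ℝ} {c : ℝ}
    (h : ∀ v ∈ P.V, f v ≤ c) (h0 : ∃ v ∈ P.V, f v ≠ c) :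
    IsProperFace P.V {y ∈ polyBody P.V | f y = c} := by
  refine ⟨⟨f, c, body_le h, rfl⟩, ?_⟩
  intro he
  obtain ⟨v, hv, hvc⟩ := h0
  have : v ∈ polyBody P.V := mem_body hv
  rw [← he] at this
  exact hvc this.2

lemma properFace_ne {d : ℕ} {V : Finset (Fin d → ℝ)} {F : Set (Fin d → ℝ)}
    {f : (Fin d → ℝ) →ₗ[ℝ] ℝ} {c : ℝ} (h : IsSupport V f c F) (hne : F ≠ polyBody V) :
    ∃ v ∈ V, f v ≠ c := by
  by_contra hc
  push Not at hc
  apply hne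
  rw [h.2]
  ext y
  constructor
  · exact fun hy => hy.1
  · intro hy
    refine ⟨hy, le_antisymm (h.1 y hy) ?_⟩
    have := body_le (V := V) (f := -f) (c := -c) (fun v hv => by simp [hc v hv]) y hy
    simpa using this

lemma SPolytope.bface_iff {d : ℕ} (P : SPolytope d) (s : Finset (Fin d → ℝ)) :
    BFace P s ↔ s ⊆ P.V ∧ ∃ f : (Fin d → ℝ) →ₗ[ℝ] ℝ, ∃ c : ℝ,
      (∀ v ∈ P.V, f v ≤ c) ∧ (∃ v ∈ P.V, f v ≠ c) ∧ ∀ v ∈ s, f v = c := by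
  constructor
  · rintro ⟨h1, F, ⟨⟨f, c, hfc⟩, hne⟩, hs⟩
    refine ⟨h1, f, c, fun v hv => hfc.1 v (mem_body hv), properFace_ne hfc hne, ?_⟩
    intro v hv
    have := hs hv
    rw [hfc.2] at this
    exact this.2
  · rintro ⟨h1, f, c, h2, h3, h4⟩
    exact ⟨h1, _, P.face_of h2 h3, fun v hv => ⟨mem_body (h1 hv), h4 v hv⟩⟩

lemma SPolytope.bface_iff_Fc {d : ℕ} (P : SPolytope d) (s : Finset (Fin d → ℝ)) :
    BFace P s ↔ Fc P.V hw s := by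
  rw [P.bface_iff]
  constructor
  · rintro ⟨h1, f, c, h2, ⟨v, hv, hvc⟩, h4⟩
    refine ⟨h1, mkl f c, ?_, ?_, ?_⟩
    · intro h
      obtain ⟨rfl, rfl⟩ := mkl_eq_zero h
      exact hvc rfl
    · intro v hv; rw [mkl_hw]; linarith [h2 v hv]
    · intro v hv; rw [mkl_hw]; linarith [h4 v hv]
  · rintro ⟨h1, ℓ, h2, h3, h4⟩
    obtain ⟨f, c, rfl⟩ := exists_mkl ℓ
    refine ⟨h1, f, c, ?_, ?_, ?_⟩
    · intro v hv; have := h3 v hv; rw [mkl_hw] at this; linarith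
    · by_contra hc
      push Not at hc
      obtain ⟨rfl, rfl⟩ := P.const_zero hc
      exact h2 mkl_zero
    · intro v hv; have := h4 v hv; rw [mkl_hw] at this; linarith

lemma SPolytope.span_hw {d : ℕ} (P : SPolytope d) :
    Submodule.span ℝ (hw '' (P.V : Set (Fin d → ℝ))) = ⊤ := by
  by_contra hne
  obtain ⟨ℓ, h0, hℓ⟩ := Submodule.exists_le_ker_of_lt_top _ (lt_top_iff_ne_top.2 hne)
  obtain ⟨f, c, rfl⟩ := exists_mkl ℓ
  obtain ⟨rfl, rfl⟩ := P.const_zero (f := f) (c := c) (by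
    intro v hv
    have : mkl f c (hw v) = 0 := hℓ (Submodule.subset_span ⟨v, hv, rfl⟩)
    rw [mkl_hw] at this; linarith)
  exact h0 mkl_zero

lemma exists_sep {d : ℕ} (T : Finset (Fin d → ℝ)) {v : Fin d → ℝ}
    (hv : v ∉ convexHull ℝ (T : Set (Fin d → ℝ))) :
    ∃ f : (Fin d → ℝ) →ₗ[ℝ] ℝ, ∀ u ∈ T, f u < f v := by
  have hcl : IsClosed (convexHull ℝ (T : Set (Fin d → ℝ))) :=
    (T.finite_toSet.isCompact_convexHull (𝕜 := ℝ)).isClosed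
  obtain ⟨f, u, h1, h2⟩ := geometric_hahn_banach_closed_point (convex_convexHull ℝ _) hcl hv
  exact ⟨f.toLinearMap, fun x hx => (h1 x (subset_convexHull ℝ _ hx)).trans h2⟩

lemma SPolytope.sc {d : ℕ} (hd : 1 ≤ d) (P : SPolytope d) : SC d P.V (hw (d := d)) where
  fr := by simp
  span := P.span_hw
  indep := by
    intro ℓ h0 hn
    obtain ⟨f, c, rfl⟩ := exists_mkl ℓ
    have hle : ∀ v ∈ P.V, f v ≤ c := fun v hv => by
      have := hn v hv; rw [mkl_hw] at this; linarith
    have hne : ∃ v ∈ P.V, f v ≠ c := by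
      by_contra hc
      push Not at hc
      obtain ⟨rfl, rfl⟩ := P.const_zero hc
      exact h0 mkl_zero
    have hA := linInd_hw (P.simplicial _ (P.face_of hle hne)).1
    exact hA.comp (fun v : {v // v ∈ P.V.filter (fun v => mkl f c (hw v) = 0)} =>
      (⟨v.1, by
        have := v.2
        rw [Finset.mem_filter, mkl_hw] at this
        exact ⟨this.1, mem_body this.1, by linarith [this.2]⟩⟩ :
        {y : Fin d → ℝ // y ∈ (P.V : Set (Fin d → ℝ)) ∩ {y ∈ polyBody P.V | f y = c}}))
      (fun a b hab => Subtype.ext (Subtype.mk.inj hab))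
  vert := by
    intro v hv
    have key : ∃ f : (Fin d → ℝ) →ₗ[ℝ] ℝ, f ≠ 0 ∧ ∀ u ∈ P.V, f u ≤ f v := by
      obtain ⟨f, hf⟩ := exists_sep _ (P.extreme v hv)
      by_cases h0 : f = 0
      · have hV : P.V.erase v = ∅ := by
          rw [Finset.eq_empty_iff_forall_notMem]
          intro u hu
          have := hf u hu
          rw [h0] at this
          simp at this
        refine ⟨LinearMap.proj ⟨0, hd⟩, ?_, ?_⟩
        · intro h
          have := congrArg (fun g => g (fun _ => 1)) h
          simp at this
        · intro u hu
          have : u = v := by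
            by_contra hne
            have := Finset.mem_erase.2 ⟨hne, hu⟩
            rw [hV] at this; simp at this
          rw [this]
      · refine ⟨f, h0, fun u hu => ?_⟩
        by_cases huv : u = v
        · rw [huv]
        · exact (hf u (Finset.mem_erase.2 ⟨huv, hu⟩)).le
    obtain ⟨f, h0, hf⟩ := key
    refine ⟨mkl f (f v), fun h => h0 (mkl_eq_zero h).1, ?_, ?_⟩
    · intro u hu; rw [mkl_hw]; linarith [hf u hu]
    · rw [mkl_hw]; ring


/-- Pairing with a fixed vector. -/
def dl {d : ℕ} (a : Fin d → ℝ) : (Fin d → ℝ) →ₗ[ℝ] ℝ where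
  toFun x := a ⬝ᵥ x
  map_add' x y := dotProduct_add a x y
  map_smul' r x := by simp [dotProduct_smul]

/-- Homogenised motion. -/
def mo {d : ℕ} (μ : (Fin d → ℝ) → (Fin d → ℝ)) (v : Fin d → ℝ) :
    Module.Dual ℝ ((Fin d → ℝ) × ℝ) := mkl (-(dl (μ v))) (-(μ v ⬝ᵥ v))

lemma mo_apply {d : ℕ} (μ : (Fin d → ℝ) → (Fin d → ℝ)) (v x : Fin d → ℝ) (t : ℝ) :
    mo μ v (x, t) = μ v ⬝ᵥ x - t * (μ v ⬝ᵥ v) := by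
  rw [mo, mkl_apply]
  simp only [dl, LinearMap.neg_apply, LinearMap.coe_mk, AddHom.coe_mk]
  ring

lemma mo_hw {d : ℕ} (μ : (Fin d → ℝ) → (Fin d → ℝ)) (u v : Fin d → ℝ) :
    mo μ u (hw v) = μ u ⬝ᵥ (v - u) := by
  rw [hw, mo_apply, dotProduct_sub]; ring

/-- Infinitesimal length change (up to sign) of an edge. -/
def cE {d : ℕ} (μ : (Fin d → ℝ) → (Fin d → ℝ)) (e : Finset (Fin d → ℝ)) : ℝ :=
  ∑ u ∈ e, ∑ v ∈ e, μ u ⬝ᵥ (v - u)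

lemma cE_pair {d : ℕ} (μ : (Fin d → ℝ) → (Fin d → ℝ)) {u v : Fin d → ℝ} (h : u ≠ v) :
    cE μ {u, v} = mo μ u (hw v) + mo μ v (hw u) := by
  rw [cE, Finset.sum_pair h, Finset.sum_pair h, Finset.sum_pair h, mo_hw, mo_hw]
  simp

lemma cE_add {d : ℕ} (μ ν : (Fin d → ℝ) → (Fin d → ℝ)) (e : Finset (Fin d → ℝ)) :
    cE (μ + ν) e = cE μ e + cE ν e := by
  simp only [cE, Pi.add_apply, add_dotProduct, Finset.sum_add_distrib]

lemma cE_smul {d : ℕ} (r : ℝ) (μ : (Fin d → ℝ) → (Fin d → ℝ)) (e : Finset (Fin d → ℝ)) :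
    cE (r • μ) e = r * cE μ e := by
  simp only [cE, Pi.smul_apply, smul_dotProduct, Finset.mul_sum, smul_eq_mul]

lemma mem_edge {d : ℕ} {P : SPolytope d} {e : Finset (Fin d → ℝ)} :
    e ∈ edgeFinset P ↔ e.card = 2 ∧ BFace P e := by
  rw [edgeFinset, Finset.mem_filter, Finset.mem_powerset]
  exact ⟨fun h => h.2, fun h => ⟨h.2.1, h⟩⟩

lemma BFace.mono {d : ℕ} {P : SPolytope d} {s t : Finset (Fin d → ℝ)} (h : BFace P t)
    (hst : s ⊆ t) : BFace P s := by
  rw [P.bface_iff_Fc] at *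
  exact h.mono hst

lemma mo_cond {d : ℕ} (P : SPolytope d) {ρ : Finset (Fin d → ℝ)}
    (μ : (Fin d → ℝ) → (Fin d → ℝ))
    (hc : ∀ e ∈ edgeFinset P, BFace P (e ∪ ρ) → cE μ e = 0) (u v : Fin d → ℝ)
    (huv : Fc P.V hw (insert u (insert v ρ))) : mo μ u (hw v) + mo μ v (hw u) = 0 := by
  by_cases h : u = v
  · subst h; rw [mo_hw]; simp
  · rw [← cE_pair μ h]
    rw [← P.bface_iff_Fc] at huv
    apply hc
    · rw [mem_edge]
      refine ⟨Finset.card_pair h, huv.mono ?_⟩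
      intro x hx; simp at hx ⊢; tauto
    · refine huv.mono ?_
      intro x hx; simp at hx ⊢; tauto

lemma SPolytope.star_rigid {d : ℕ} (hd : 3 ≤ d) (P : SPolytope d) {ρ : Finset (Fin d → ℝ)}
    (hρ : BFace P ρ) (hρc : ρ.card ≤ d - 3) (μ : (Fin d → ℝ) → (Fin d → ℝ))
    (hc : ∀ e ∈ edgeFinset P, BFace P (e ∪ ρ) → cE μ e = 0) :
    ∃ B : ((Fin d → ℝ) × ℝ) →ₗ[ℝ] Module.Dual ℝ ((Fin d → ℝ) × ℝ),
      (∀ x y, B x y + B y x = 0) ∧ ∀ v, BFace P (insert v ρ) → mo μ v = B (hw v) := by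
  obtain ⟨B, h1, h2⟩ := (P.sc (by omega)).star hd ((P.bface_iff_Fc _).1 hρ) hρc (mo μ)
    (mo_cond P μ hc)
  exact ⟨B, h1, fun v hv => h2 v ((P.bface_iff_Fc _).1 hv)⟩

lemma SPolytope.vert_face {d : ℕ} (hd : 1 ≤ d) (P : SPolytope d) {v : Fin d → ℝ} (hv : v ∈ P.V) :
    BFace P {v} := by
  rw [P.bface_iff_Fc]
  obtain ⟨ℓ, h1, h2, h3⟩ := (P.sc hd).vert v hv
  exact ⟨by simpa using hv, ℓ, h1, h2, by simpa using h3⟩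

lemma SPolytope.nonempty {d : ℕ} (P : SPolytope d) : P.V.Nonempty := by
  rw [Finset.nonempty_iff_ne_empty]
  intro h
  have := P.span_top
  rw [h] at this
  simp at this

lemma SPolytope.empty_face {d : ℕ} (hd : 1 ≤ d) (P : SPolytope d) : BFace P ∅ := by
  obtain ⟨v, hv⟩ := P.nonempty
  exact (P.vert_face hd hv).mono (by simp)

lemma SPolytope.rigid {d : ℕ} (hd : 3 ≤ d) (P : SPolytope d) (μ : (Fin d → ℝ) → (Fin d → ℝ))
    (hc : ∀ e ∈ edgeFinset P, cE μ e = 0) :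
    ∃ B : ((Fin d → ℝ) × ℝ) →ₗ[ℝ] Module.Dual ℝ ((Fin d → ℝ) × ℝ),
      (∀ x y, B x y + B y x = 0) ∧ ∀ v ∈ P.V, mo μ v = B (hw v) := by
  obtain ⟨B, h1, h2⟩ := P.star_rigid hd (P.empty_face (by omega)) (by simp) μ
    (fun e he _ => hc e he)
  exact ⟨B, h1, fun v hv => h2 v (by simpa using P.vert_face (by omega) hv)⟩

lemma mo_zero {d : ℕ} {μ : (Fin d → ℝ) → (Fin d → ℝ)} {v : Fin d → ℝ}
    (h : ∀ x, mo μ v (x, 0) = 0) : μ v = 0 := by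
  have := h (μ v)
  rw [mo_apply] at this
  simp only [zero_mul, sub_zero] at this
  exact dotProduct_self_eq_zero.1 this

/-- Extension by zero. -/
def exZ {d : ℕ} (V : Finset (Fin d → ℝ)) (μ : {v // v ∈ V} → Fin d → ℝ) :
    (Fin d → ℝ) → (Fin d → ℝ) := fun v => if h : v ∈ V then μ ⟨v, h⟩ else 0

lemma exZ_add {d : ℕ} (V : Finset (Fin d → ℝ)) (μ ν : {v // v ∈ V} → Fin d → ℝ) :
    exZ V (μ + ν) = exZ V μ + exZ V ν := by
  funext v
  by_cases h : v ∈ V <;> simp [exZ, h]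

lemma exZ_smul {d : ℕ} (V : Finset (Fin d → ℝ)) (r : ℝ) (μ : {v // v ∈ V} → Fin d → ℝ) :
    exZ V (r • μ) = r • exZ V μ := by
  funext v
  by_cases h : v ∈ V <;> simp [exZ, h]

/-- Rigidity map of `P`, augmented. -/
def bigL {d : ℕ} (P : SPolytope d) (G : Finset (Fin d → ℝ))
    (a b : {e // e ∈ Finset.powersetCard 2 G} → Fin d → ℝ) :
    ({v // v ∈ P.V} → Fin d → ℝ) →ₗ[ℝ]
      ({e // e ∈ edgeFinset P} → ℝ) × ({e // e ∈ Finset.powersetCard 2 G} → ℝ) where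
  toFun μ := (fun e => cE (exZ P.V μ) e.1, fun e => exZ P.V μ (a e) ⬝ᵥ (b e - a e))
  map_add' μ ν := by
    apply Prod.ext
    · funext e; simp [exZ_add, cE_add]
    · funext e; simp only [exZ_add, Pi.add_apply, Prod.snd_add, add_dotProduct]
  map_smul' r μ := by
    apply Prod.ext
    · funext e; simp [exZ_smul, cE_smul]
    · funext e; simp only [exZ_smul, Pi.smul_apply, Prod.smul_snd, smul_dotProduct, RingHom.id_apply]

lemma SPolytope.exists_bigL {d : ℕ} (hd : 3 ≤ d) (P : SPolytope d) :
    ∃ (G : Finset (Fin d → ℝ)) (a b : {e // e ∈ Finset.powersetCard 2 G} → Fin d → ℝ),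
      G.card = d + 1 ∧ Function.Injective (bigL P G a b) := by
  have hsc := P.sc (by omega)
  obtain ⟨F, -, hF⟩ := hsc.extend ((P.bface_iff_Fc _).1 (P.empty_face (by omega)))
  obtain ⟨z, hzV, hzF⟩ := hsc.off hF
  set G := insert z F with hG
  have hGV : ∀ x ∈ G, x ∈ P.V := by
    intro x hx
    rw [hG, Finset.mem_insert] at hx
    rcases hx with rfl | hx
    · exact hzV
    · exact hF.1.1 hx
  have hab : ∀ e : {e // e ∈ Finset.powersetCard 2 G}, ∃ a b : Fin d → ℝ, a ≠ b ∧ e.1 = {a, b} := by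
    intro e
    obtain ⟨a, b, h1, h2⟩ := Finset.card_eq_two.1 (Finset.mem_powersetCard.1 e.2).2
    exact ⟨a, b, h1, h2⟩
  choose a b hne he using hab
  refine ⟨G, a, b, by rw [hG, Finset.card_insert_of_notMem hzF, hF.2], ?_⟩
  rw [← LinearMap.ker_eq_bot, LinearMap.ker_eq_bot']
  intro μ hμ
  have h1 : ∀ e ∈ edgeFinset P, cE (exZ P.V μ) e = 0 := fun e he =>
    congrFun (congrArg Prod.fst hμ) ⟨e, he⟩
  have h2 : ∀ e, exZ P.V μ (a e) ⬝ᵥ (b e - a e) = 0 := fun e => congrFun (congrArg Prod.snd hμ) e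
  obtain ⟨B, Ba, Bm⟩ := P.rigid hd _ h1
  have hB1 : ∀ x ∈ G, ∀ y ∈ G, B (hw x) (hw y) = 0 := by
    intro x hx y hy
    by_cases hxy : x = y
    · subst hxy; linarith [Ba (hw x) (hw x)]
    · have hmem : ({x, y} : Finset (Fin d → ℝ)) ∈ Finset.powersetCard 2 G := by
        rw [Finset.mem_powersetCard]
        refine ⟨?_, Finset.card_pair hxy⟩
        intro t ht; simp at ht; rcases ht with rfl | rfl <;> assumption
      have e0 := h2 ⟨_, hmem⟩
      have e1 := he ⟨_, hmem⟩
      have e2 := hne ⟨_, hmem⟩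
      set A := a ⟨_, hmem⟩
      set C := b ⟨_, hmem⟩
      have hA : A ∈ ({x, y} : Finset (Fin d → ℝ)) := by simp only at e1; rw [e1]; simp
      have hC : C ∈ ({x, y} : Finset (Fin d → ℝ)) := by simp only at e1; rw [e1]; simp
      have hAV : A ∈ P.V := by
        simp at hA; rcases hA with h | h
        · rw [h]; exact hGV _ hx
        · rw [h]; exact hGV _ hy
      rw [← mo_hw, Bm A hAV] at e0
      simp only [Finset.mem_insert, Finset.mem_singleton] at hA hC
      rcases hA with hA | hA <;> rcases hC with hC | hC
      · exact absurd (hA.trans hC.symm) e2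
      · rw [hA, hC] at e0; exact e0
      · rw [hA, hC] at e0; linarith [Ba (hw x) (hw y)]
      · exact absurd (hA.trans hC.symm) e2
  have hB2 : ∀ x ∈ G, B (hw x) = 0 := by
    intro x hx
    exact hsc.ext1 hF hzV hzF (fun v hv => hB1 x hx v (by simp [hG, hv])) (hB1 x hx z (by simp [hG]))
  have hB3 : ∀ y x, B y (hw x) = 0 ∨ x ∉ G := by
    intro y x
    by_cases hx : x ∈ G
    · left
      have := Ba y (hw x)
      rw [hB2 x hx] at this
      simpa using this
    · exact Or.inr hx
  have hB4 : ∀ y, B y = 0 := by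
    intro y
    exact hsc.ext1 hF hzV hzF (fun v hv => (hB3 y v).resolve_right (by simp [hG, hv]))
      ((hB3 y z).resolve_right (by simp [hG]))
  funext v
  have : exZ P.V μ v = 0 := by
    apply mo_zero
    intro x
    rw [Bm v.1 v.2, hB4]; rfl
  rw [exZ, dif_pos v.2] at this
  exact this

lemma SPolytope.g2_nonneg {d : ℕ} (hd : 3 ≤ d) (P : SPolytope d) : 0 ≤ g2 P := by
  obtain ⟨G, a, b, hG, hinj⟩ := P.exists_bigL hd
  have := LinearMap.finrank_le_finrank_of_injective hinj
  simp only [Module.finrank_pi, Module.finrank_pi_fintype, Module.finrank_prod, Finset.sum_const,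
    Fintype.card_coe, Finset.card_univ, Fintype.card_fin, smul_eq_mul, Finset.card_powersetCard, hG] at this
  rw [g2, f0, f1]
  have h2 : ((P.V.card * d : ℕ) : ℤ) ≤ (((edgeFinset P).card + (d + 1).choose 2 : ℕ) : ℤ) := by
    exact_mod_cast this
  push_cast at h2
  linarith

lemma SPolytope.dual_motion {d : ℕ} (hd : 3 ≤ d) (P : SPolytope d) (h0 : g2 P = 0)
    (e0 : Finset (Fin d → ℝ)) :
    ∃ μ : (Fin d → ℝ) → (Fin d → ℝ), ∀ e ∈ edgeFinset P, cE μ e = if e = e0 then 1 else 0 := by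
  obtain ⟨G, a, b, hG, hinj⟩ := P.exists_bigL hd
  have hsurj : Function.Surjective (bigL P G a b) := by
    rw [← LinearMap.injective_iff_surjective_of_finrank_eq_finrank]
    · exact hinj
    · simp only [Module.finrank_pi, Module.finrank_pi_fintype, Module.finrank_prod,
        Finset.sum_const,
        Fintype.card_coe, Finset.card_univ, Fintype.card_fin, smul_eq_mul,
        Finset.card_powersetCard, hG]
      rw [g2, f0, f1] at h0
      zify
      linarith
  obtain ⟨μ, hμ⟩ := hsurj (fun e => if e.1 = e0 then 1 else 0, 0)
  refine ⟨exZ P.V μ, fun e he => ?_⟩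
  exact congrFun (congrArg Prod.fst hμ) ⟨e, he⟩

/-- Half of a finite set with a free involution. -/
lemma exists_half {α : Type*} (S : Finset α) (σ : α → α) (h1 : ∀ x, σ (σ x) = x)
    (h2 : ∀ x ∈ S, σ x ∈ S) (h3 : ∀ x ∈ S, σ x ≠ x) :
    ∃ H ⊆ S, (∀ x ∈ S, x ∈ H ∨ σ x ∈ H) ∧ (∀ x ∈ H, σ x ∉ H) ∧ 2 * H.card = S.card := by
  let r : α → α → Prop := WellOrderingRel
  have tri : ∀ a b, r a b ∨ a = b ∨ r b a := fun a b => by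
    rcases Std.Trichotomous.rel_or_eq_or_rel_swap (r := r) (a := a) (b := b) with h | h | h <;> tauto
  have asy : ∀ a b, r a b → ¬ r b a := fun a b h h' => asymm_of r h h'
  refine ⟨S.filter (fun x => r x (σ x)), Finset.filter_subset _ _, ?_, ?_, ?_⟩
  · intro x hx
    rcases tri x (σ x) with h | h | h
    · left; simp [hx, h]
    · exact absurd h.symm (h3 x hx)
    · right; simp [h2 x hx, h1, h]
  · intro x hx
    rw [Finset.mem_filter] at hx ⊢
    rw [h1]
    exact fun hh => asy _ _ hx.2 hh.2
  · have : (S.filter (fun x => r x (σ x))).card = (S.filter (fun x => ¬ r x (σ x))).card := by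
      apply Finset.card_bij (fun x _ => σ x)
      · intro x hx
        rw [Finset.mem_filter] at hx ⊢
        refine ⟨h2 x hx.1, ?_⟩
        rw [h1]; exact asy _ _ hx.2
      · intro x _ y _ hxy
        rw [← h1 x, hxy, h1]
      · intro y hy
        rw [Finset.mem_filter] at hy
        refine ⟨σ y, ?_, h1 y⟩
        rw [Finset.mem_filter, h1]
        refine ⟨h2 y hy.1, ?_⟩
        rcases tri y (σ y) with h | h | h
        · exact absurd h hy.2
        · exact absurd h.symm (h3 y hy.1)
        · exact h
    have h4 := Finset.card_filter_add_card_filter_not (s := S) (fun x => r x (σ x))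
    omega

lemma IsCS.bface {d : ℕ} {P : SPolytope d} (h : IsCS P) {s : Finset (Fin d → ℝ)}
    (hs : BFace P s) : BFace P (s.image (fun x => -x)) := by
  rw [P.bface_iff] at hs ⊢
  obtain ⟨h1, f, c, h2, ⟨v, hv, hvc⟩, h4⟩ := hs
  refine ⟨?_, -f, c, ?_, ⟨-v, h v hv, by simpa using hvc⟩, ?_⟩
  · intro x hx
    rw [Finset.mem_image] at hx
    obtain ⟨y, hy, rfl⟩ := hx
    exact h y (h1 hy)
  · intro v hv
    have := h2 (-v) (h v hv)
    simpa using this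
  · intro x hx
    rw [Finset.mem_image] at hx
    obtain ⟨y, hy, rfl⟩ := hx
    simpa using h4 y hy

lemma IsCS.no_antipodal {d : ℕ} {P : SPolytope d} (h : IsCS P) {s : Finset (Fin d → ℝ)}
    (hs : BFace P s) {v : Fin d → ℝ} (hv : v ∈ s) : -v ∉ s := by
  intro hv'
  rw [P.bface_iff] at hs
  obtain ⟨h1, f, c, h2, ⟨u, hu, huc⟩, h4⟩ := hs
  have e1 := h4 v hv
  have e2 := h4 _ hv'
  rw [map_neg] at e2
  have hc : c = 0 := by linarith
  have e3 := h2 u hu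
  have e4 := h2 _ (h u hu)
  rw [map_neg] at e4
  apply huc
  linarith

lemma IsCS.neg_ne {d : ℕ} (hd : 1 ≤ d) {P : SPolytope d} (h : IsCS P) {v : Fin d → ℝ}
    (hv : v ∈ P.V) : -v ≠ v := by
  intro hh
  have := h.no_antipodal (P.vert_face hd hv) (v := v) (by simp)
  simp [hh] at this

/-- Even extension. -/
def exE {d : ℕ} (V : Finset (Fin d → ℝ)) (μ : {v // v ∈ V} → Fin d → ℝ) :
    (Fin d → ℝ) → (Fin d → ℝ) := fun v => if h : v ∈ V then μ ⟨v, h⟩ else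
      if h : -v ∈ V then μ ⟨-v, h⟩ else 0

lemma exE_add {d : ℕ} (V : Finset (Fin d → ℝ)) (μ ν : {v // v ∈ V} → Fin d → ℝ) :
    exE V (μ + ν) = exE V μ + exE V ν := by
  funext v
  by_cases h : v ∈ V <;> by_cases h' : -v ∈ V <;> simp [exE, h, h']

lemma exE_smul {d : ℕ} (V : Finset (Fin d → ℝ)) (r : ℝ) (μ : {v // v ∈ V} → Fin d → ℝ) :
    exE V (r • μ) = r • exE V μ := by
  funext v
  by_cases h : v ∈ V <;> by_cases h' : -v ∈ V <;> simp [exE, h, h']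

/-- Rigidity map for even motions. -/
def evL {d : ℕ} (H : Finset (Fin d → ℝ)) (E : Finset (Finset (Fin d → ℝ))) (v0 : Fin d → ℝ) :
    ({v // v ∈ H} → Fin d → ℝ) →ₗ[ℝ] ({e // e ∈ E} → ℝ) × (Fin d → ℝ) where
  toFun μ := (fun e => cE (exE H μ) e.1, exE H μ v0)
  map_add' μ ν := by
    apply Prod.ext
    · funext e; simp [exE_add, cE_add]
    · funext e; simp [exE_add]
  map_smul' r μ := by
    apply Prod.ext
    · funext e; simp [exE_smul, cE_smul]
    · funext e; simp [exE_smul]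

lemma cE_neg {d : ℕ} {μ : (Fin d → ℝ) → (Fin d → ℝ)} (hμ : ∀ v, μ (-v) = μ v)
    (e : Finset (Fin d → ℝ)) : cE μ (e.image (fun x => -x)) = - cE μ e := by
  rw [cE, Finset.sum_image (by intro a _ b _ h; simpa using h), cE, ← Finset.sum_neg_distrib]
  apply Finset.sum_congr rfl
  intro u _
  rw [Finset.sum_image (by intro a _ b _ h; simpa using h), ← Finset.sum_neg_distrib]
  apply Finset.sum_congr rfl
  intro v _
  rw [hμ, ← dotProduct_neg]
  congr 1
  abel

lemma IsCS.g2_ge {d : ℕ} (hd : 3 ≤ d) {P : SPolytope d} (h : IsCS P) :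
    (d.choose 2 : ℤ) - d ≤ g2 P := by
  obtain ⟨H, hHV, hH1, hH2, hH3⟩ := exists_half P.V (fun x => -x) (by simp) h
    (fun v hv => h.neg_ne (by omega) hv)
  obtain ⟨E, hEV, hE1, hE2, hE3⟩ := exists_half (edgeFinset P)
    (fun e => e.image (fun x => -x)) (by intro e; simp [Finset.image_image, Function.comp_def]) (by
      intro e he
      rw [mem_edge] at he ⊢
      exact ⟨by rw [Finset.card_image_of_injective _ neg_injective, he.1], h.bface he.2⟩) (by
      intro e he hh
      rw [mem_edge] at he
      have : e.Nonempty := by rw [← Finset.card_pos]; omega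
      obtain ⟨v, hv⟩ := this
      apply h.no_antipodal he.2 hv
      rw [← hh]
      exact Finset.mem_image_of_mem _ hv)
  have hne : H.Nonempty := by
    rw [← Finset.card_pos]
    have := P.nonempty.card_pos
    omega
  obtain ⟨v0, hv0⟩ := hne
  have hinj : Function.Injective (evL H E v0) := by
    rw [← LinearMap.ker_eq_bot, LinearMap.ker_eq_bot']
    intro μ hμ
    have h1 : ∀ e ∈ E, cE (exE H μ) e = 0 := fun e he =>
      congrFun (congrArg Prod.fst hμ) ⟨e, he⟩
    have h2 : exE H μ v0 = 0 := congrArg Prod.snd hμ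
    have hev : ∀ v, exE H μ (-v) = exE H μ v := by
      intro v
      by_cases hv : v ∈ H
      · have : -v ∉ H := hH2 v hv
        simp [exE, hv, this]
      · by_cases hv' : -v ∈ H <;> simp [exE, hv, hv']
    obtain ⟨B, Ba, Bm⟩ := P.rigid hd (exE H μ) (by
      intro e he
      rcases hE1 e he with hh | hh
      · exact h1 e hh
      · have := h1 _ hh
        rw [cE_neg hev] at this
        linarith)
    have hB : ∀ v ∈ P.V, ∀ x, B (v, 0) (x, 0) = 0 := by
      intro v hv x
      have e1 : B (hw v) (x, 0) = B (hw (-v)) (x, 0) := by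
        rw [← Bm v hv, ← Bm _ (h v hv), mo_apply, mo_apply, hev]; simp
      have e2 : hw v - hw (-v) = (2 : ℝ) • ((v, 0) : (Fin d → ℝ) × ℝ) := by
        ext <;> simp [hw]; ring
      have e3 : B ((2 : ℝ) • ((v, 0) : (Fin d → ℝ) × ℝ)) (x, 0) = 0 := by
        rw [← e2, map_sub, LinearMap.sub_apply, e1, sub_self]
      rw [map_smul, LinearMap.smul_apply, smul_eq_mul] at e3
      linarith
    have hB' : ∀ v ∈ P.V, ∀ x, mo (exE H μ) v (x, 0) = B (0, 1) (x, 0) := by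
      intro v hv x
      rw [Bm v hv]
      have : hw v = (v, 0) + (0, 1) := by simp [hw]
      rw [this, map_add, LinearMap.add_apply, hB v hv, zero_add]
    have hB0 : ∀ x, B (0, 1) (x, 0) = 0 := by
      intro x
      rw [← hB' v0 (hHV hv0), mo_apply, h2]; simp
    funext v
    have : exE H μ v = 0 := mo_zero (fun x => by rw [hB' v.1 (hHV v.2), hB0])
    rw [exE, dif_pos v.2] at this
    exact this
  have := LinearMap.finrank_le_finrank_of_injective hinj
  simp only [Module.finrank_pi, Module.finrank_pi_fintype, Module.finrank_prod, Finset.sum_const,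
    Fintype.card_coe, Finset.card_univ, Fintype.card_fin, smul_eq_mul] at this
  have e1 : (d + 1).choose 2 = d + d.choose 2 := by
    rw [Nat.choose_succ_succ' d 1]; simp
  rw [g2, f0, f1, e1, ← hH3, ← hE3]
  have h2 : ((H.card * d : ℕ) : ℤ) ≤ ((E.card + d : ℕ) : ℤ) := by
    exact_mod_cast this
  push_cast at h2 ⊢
  linarith


lemma cE_zero {d : ℕ} (e : Finset (Fin d → ℝ)) : cE (0 : (Fin d → ℝ) → (Fin d → ℝ)) e = 0 := by
  simp [cE]

lemma cE_sum {d : ℕ} {κ : Type*} (s : Finset κ) (μ : κ → (Fin d → ℝ) → (Fin d → ℝ))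
    (e : Finset (Fin d → ℝ)) : cE (∑ i ∈ s, μ i) e = ∑ i ∈ s, cE (μ i) e := by
  induction s using Finset.induction_on with
  | empty => simp [cE_zero]
  | insert a s ha ih => rw [Finset.sum_insert ha, Finset.sum_insert ha, cE_add, ih]

lemma SPolytope.clique_step {d : ℕ} (hd : 3 ≤ d) (P : SPolytope d) (h0 : g2 P = 0)
    {ρ : Finset (Fin d → ℝ)} (hρc : ρ.card ≤ d - 3) {u v : Fin d → ℝ} (huv : u ≠ v)
    (hu : BFace P (insert u ρ)) (hv : BFace P (insert v ρ)) (he : BFace P {u, v}) :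
    BFace P (insert u (insert v ρ)) := by
  by_contra hn
  obtain ⟨μ, hμ⟩ := P.dual_motion hd h0 {u, v}
  obtain ⟨B, Ba, Bm⟩ := P.star_rigid hd (hu.mono (Finset.subset_insert _ _)) hρc μ (by
    intro e hee hb
    rw [hμ e hee, if_neg]
    rintro rfl
    apply hn
    convert hb using 1
    ext x; simp only [Finset.mem_insert, Finset.mem_union, Finset.mem_singleton]; tauto)
  have h1 := hμ {u, v} (mem_edge.2 ⟨Finset.card_pair huv, he⟩)
  rw [if_pos rfl, cE_pair μ huv, Bm u hu, Bm v hv, Ba] at h1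
  exact zero_ne_one h1

lemma SPolytope.clique_face {d : ℕ} (hd : 3 ≤ d) (P : SPolytope d) (h0 : g2 P = 0) (n : ℕ) :
    ∀ s : Finset (Fin d → ℝ), s.card = n → s.card ≤ d - 1 → s ⊆ P.V →
      (∀ u ∈ s, ∀ v ∈ s, u ≠ v → BFace P {u, v}) → BFace P s := by
  induction n using Nat.strong_induction_on with
  | _ n ih =>
    intro s hn hs hsV hcl
    by_cases h2 : s.card ≤ 1
    · rcases Finset.card_le_one_iff_subset_singleton.1 h2 with ⟨x, hx⟩
      rcases Finset.subset_singleton_iff.1 hx with rfl | rfl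
      · exact P.empty_face (by omega)
      · exact P.vert_face (by omega) (hsV (by simp))
    · obtain ⟨u, hu, v, hv, huv⟩ := Finset.one_lt_card.1 (not_le.1 h2)
      set ρ := (s.erase u).erase v with hρ
      have hvu : v ∈ s.erase u := Finset.mem_erase.2 ⟨huv.symm, hv⟩
      have c1 := Finset.card_erase_of_mem hu
      have c2 : ρ.card = (s.erase u).card - 1 := Finset.card_erase_of_mem hvu
      have e1 : insert v ρ = s.erase u := Finset.insert_erase hvu
      have e2 : insert u (insert v ρ) = s := by rw [e1, Finset.insert_erase hu]
      have e3 : insert u ρ = s.erase v := by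
        rw [hρ, Finset.erase_right_comm, Finset.insert_erase]
        exact Finset.mem_erase.2 ⟨huv, hu⟩
      rw [← e2]
      apply P.clique_step hd h0 (by omega) huv
      · rw [e3]
        have := Finset.card_erase_of_mem hv
        exact ih (s.erase v).card (by omega) _ rfl (by omega) ((Finset.erase_subset _ _).trans hsV)
          (fun a ha b hb => hcl a (Finset.mem_of_mem_erase ha) b (Finset.mem_of_mem_erase hb))
      · rw [e1]
        exact ih (s.erase u).card (by omega) _ rfl (by omega) ((Finset.erase_subset _ _).trans hsV)
          (fun a ha b hb => hcl a (Finset.mem_of_mem_erase ha) b (Finset.mem_of_mem_erase hb))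
      · exact hcl u hu v hv huv

lemma SPolytope.clique_face' {d : ℕ} (hd : 3 ≤ d) (P : SPolytope d) (h0 : g2 P = 0)
    (hno : ¬ ∃ σ : Finset (Fin d → ℝ), IsMissingFace P σ ∧ σ.card = d)
    {s : Finset (Fin d → ℝ)} (hs : s.card = d) (hsV : s ⊆ P.V)
    (hcl : ∀ u ∈ s, ∀ v ∈ s, u ≠ v → BFace P {u, v}) : BFace P s := by
  by_contra hn
  apply hno
  refine ⟨s, ⟨hsV, hn, ?_⟩, hs⟩
  intro τ hτ
  have := Finset.card_lt_card hτ
  exact P.clique_face hd h0 _ τ rfl (by omega) (hτ.1.trans hsV)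
    (fun a ha b hb => hcl a (hτ.1 ha) b (hτ.1 hb))

lemma SPolytope.simplex_of_facets {d : ℕ} (hd : 1 ≤ d) (P : SPolytope d)
    {G : Finset (Fin d → ℝ)} (hG : G.card = d + 1)
    (hF : ∀ g ∈ G, BFace P (G.erase g)) : P.V.card = d + 1 := by
  have hsc := P.sc hd
  have hGV : G ⊆ P.V := by
    intro x hx
    obtain ⟨y, hy, hxy⟩ := Finset.exists_mem_ne (by omega : 1 < G.card) x
    exact (hF y hy).1 (Finset.mem_erase.2 ⟨hxy.symm, hx⟩)
  have hft : ∀ g ∈ G, Ft d P.V hw (G.erase g) := fun g hg =>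
    ⟨(P.bface_iff_Fc _).1 (hF g hg), by rw [Finset.card_erase_of_mem hg, hG]; rfl⟩
  suffices h : P.V ⊆ G by rw [Finset.Subset.antisymm h hGV, hG]
  intro x hx
  by_contra hxG
  obtain ⟨f, hf⟩ := exists_sep _ (P.extreme x hx)
  have hL : ∀ g, ∃ ℓ : Module.Dual ℝ ((Fin d → ℝ) × ℝ), g ∈ G →
      (∀ v ∈ G.erase g, ℓ (hw v) = 0) ∧ ∀ v ∈ P.V, v ∉ G.erase g → 0 < ℓ (hw v) := by
    intro g
    by_cases hg : g ∈ G
    · obtain ⟨ℓ, h1, h2, h3, h4⟩ := Ft.func hsc (hft g hg)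
      exact ⟨ℓ, fun _ => ⟨h3, h4⟩⟩
    · exact ⟨0, fun h => absurd h hg⟩
  choose L hL using hL
  have hLg : ∀ g ∈ G, 0 < L g (hw g) := fun g hg => (hL g hg).2 g (hGV hg) (by simp)
  have hLx : ∀ g ∈ G, 0 < L g (hw x) := fun g hg => (hL g hg).2 x hx (fun h =>
    hxG (Finset.mem_of_mem_erase h))
  obtain ⟨q, hq⟩ : G.Nonempty := by rw [← Finset.card_pos]; omega
  have key : mkl f (f x) - ∑ g ∈ G, (mkl f (f x) (hw g) / L g (hw g)) • L g = 0 := by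
    have hall : ∀ v ∈ G, (mkl f (f x) - ∑ g ∈ G, (mkl f (f x) (hw g) / L g (hw g)) • L g) (hw v)
        = 0 := by
      intro v hv
      rw [LinearMap.sub_apply, LinearMap.sum_apply, Finset.sum_eq_single v]
      · rw [LinearMap.smul_apply, smul_eq_mul, div_mul_cancel₀ _ (hLg v hv).ne', sub_self]
      · intro g hg hgv
        rw [LinearMap.smul_apply, (hL g hg).1 v (Finset.mem_erase.2 ⟨hgv.symm, hv⟩), smul_zero]
      · exact fun h => absurd hv h
    exact hsc.ext1 (hft q hq) (hGV hq) (by simp)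
      (fun v hv => hall v (Finset.mem_of_mem_erase hv)) (hall q hq)
  have h1 := congrArg (fun g => g (hw x)) key
  simp only [LinearMap.sub_apply, LinearMap.sum_apply, LinearMap.smul_apply, smul_eq_mul,
    LinearMap.zero_apply] at h1
  rw [mkl_hw, sub_self, zero_sub, neg_eq_zero] at h1
  have : 0 < ∑ g ∈ G, mkl f (f x) (hw g) / L g (hw g) * L g (hw x) := by
    apply Finset.sum_pos _ ⟨q, hq⟩
    intro g hg
    apply mul_pos (div_pos _ (hLg g hg)) (hLx g hg)
    rw [mkl_hw]
    have := hf g (Finset.mem_erase.2 ⟨fun h => hxG (h ▸ hg), hGV hg⟩)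
    linarith
  linarith

lemma exists_dl {d : ℕ} (f : (Fin d → ℝ) →ₗ[ℝ] ℝ) : ∃ a : Fin d → ℝ, ∀ x, a ⬝ᵥ x = f x := by
  refine ⟨fun i => f (Pi.single i 1), fun x => ?_⟩
  have : dl (fun i => f (Pi.single i 1)) = f := by
    ext i; simp [dl]
  exact LinearMap.congr_fun this x

lemma SPolytope.exists_missing {d : ℕ} (hd : 4 ≤ d) (P : SPolytope d) (h0 : g2 P = 0)
    (hc : P.V.card ≠ d + 1) : ∃ σ : Finset (Fin d → ℝ), IsMissingFace P σ ∧ σ.card = d := by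
  by_contra hno
  have hsc := P.sc (by omega)
  obtain ⟨F, -, hF⟩ := hsc.extend ((P.bface_iff_Fc _).1 (P.empty_face (by omega)))
  obtain ⟨p, hp⟩ : F.Nonempty := by rw [← Finset.card_pos, hF.2]; omega
  obtain ⟨R, hR⟩ : ∃ R, R = F.erase p := ⟨_, rfl⟩
  have hpR : p ∉ R := by simp [hR]
  have hFR : F = insert p R := by rw [hR, Finset.insert_erase hp]
  rw [hFR] at hF
  clear hFR hp hR
  obtain ⟨q, hqV, hqF, hQ⟩ := hsc.ridge hpR hF
  have hqR : q ∉ R := fun h => hqF (by simp [h])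
  have hpq : p ≠ q := fun h => hqF (by simp [h])
  have hpV : p ∈ P.V := hF.1.1 (by simp)
  have hRc : R.card = d - 1 := by
    have := hF.2
    rw [Finset.card_insert_of_notMem hpR] at this; omega
  have bP := (P.bface_iff_Fc _).2 hF.1
  have bQ := (P.bface_iff_Fc _).2 hQ.1
  have pairP : ∀ u ∈ insert p R, ∀ v ∈ insert p R, BFace P {u, v} := by
    intro u hu v hv
    apply bP.mono
    intro x hx
    rw [Finset.mem_insert, Finset.mem_singleton] at hx
    rcases hx with rfl | rfl <;> assumption
  have pairQ : ∀ u ∈ insert q R, ∀ v ∈ insert q R, BFace P {u, v} := by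
    intro u hu v hv
    apply bQ.mono
    intro x hx
    rw [Finset.mem_insert, Finset.mem_singleton] at hx
    rcases hx with rfl | rfl <;> assumption
  by_cases hedge : BFace P {p, q}
  · apply hc
    apply P.simplex_of_facets (by omega) (G := insert q (insert p R))
    · rw [Finset.card_insert_of_notMem hqF, hF.2]
    · intro g hg
      apply P.clique_face' (by omega) h0 hno
      · rw [Finset.card_erase_of_mem hg, Finset.card_insert_of_notMem hqF, hF.2]; rfl
      · intro x hx
        have := Finset.mem_of_mem_erase hx
        rw [Finset.mem_insert] at this
        rcases this with rfl | h
        · exact hqV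
        · exact hF.1.1 h
      · intro u hu v hv huv
        have hu' := Finset.mem_of_mem_erase hu
        have hv' := Finset.mem_of_mem_erase hv
        clear hu hv
        rw [Finset.mem_insert, Finset.mem_insert] at hu' hv'
        rcases hu' with hu | hu | hu <;> rcases hv' with hv | hv | hv
        · exact absurd (hu.trans hv.symm) huv
        · rw [hu, hv, Finset.pair_comm]; exact hedge
        · exact pairQ _ (by simp [hu]) _ (by simp [hv])
        · rw [hu, hv]; exact hedge
        · exact absurd (hu.trans hv.symm) huv
        · exact pairP _ (by simp [hu]) _ (by simp [hv])
        · exact pairQ _ (by simp [hu]) _ (by simp [hv])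
        · exact pairP _ (by simp [hu]) _ (by simp [hv])
        · exact pairP _ (by simp [hu]) _ (by simp [hv])
  · obtain ⟨g, gq, gF⟩ := hsc.interp hF hqV hqF (fun _ => 0) 1
    obtain ⟨f, c, rfl⟩ := exists_mkl g
    obtain ⟨a, ha⟩ := exists_dl (-f)
    set μ : (Fin d → ℝ) → (Fin d → ℝ) := fun v => if v = p then a else 0 with hμ
    have hμp : ∀ r, r ≠ p → cE μ {p, r} = mkl f c (hw r) - mkl f c (hw p) := by
      intro r hr
      rw [cE_pair μ hr.symm, mo_hw, mo_hw]
      simp only [hμ, if_true, if_neg hr, zero_dotProduct, ha, mkl_hw, LinearMap.neg_apply, map_sub]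
      ring
    have hpz := gF p (by simp)
    have hμpq : cE μ {p, q} = 1 := by rw [hμp q hpq.symm, gq, hpz, sub_zero]
    choose D hD using fun e0 => P.dual_motion (by omega) h0 e0
    set G := insert q (insert p R) with hGdef
    set S := (edgeFinset P).filter (fun e => ¬ e ⊆ G) with hS
    set μ' := μ + ∑ e0 ∈ S, (-(cE μ e0)) • D e0 with hμ'
    have hcE' : ∀ e, cE μ' e = cE μ e + ∑ e0 ∈ S, (-(cE μ e0)) * cE (D e0) e := by
      intro e
      rw [hμ', cE_add, cE_sum]
      congr 1
      exact Finset.sum_congr rfl (fun i _ => cE_smul _ _ _)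
    have hK : ∀ e ∈ edgeFinset P, e ⊆ G → cE μ e = 0 := by
      intro e he heG
      rw [mem_edge] at he
      by_cases hpe : p ∈ e
      · have hcard := Finset.card_erase_of_mem hpe
        rw [he.1] at hcard
        obtain ⟨r, hr⟩ := Finset.card_eq_one.1 hcard
        have her : e = {p, r} := by rw [← Finset.insert_erase hpe, hr]
        have hrm : r ∈ e.erase p := by rw [hr]; simp
        have hrp : r ≠ p := (Finset.mem_erase.1 hrm).1
        rw [her, hμp r hrp, hpz, sub_zero]
        apply gF
        have := heG (Finset.mem_of_mem_erase hrm)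
        rw [hGdef, Finset.mem_insert] at this
        rcases this with rfl | h
        · rw [her] at he; exact absurd he.2 hedge
        · exact h
      · rw [cE]
        apply Finset.sum_eq_zero
        intro u hu
        apply Finset.sum_eq_zero
        intro v _
        have : u ≠ p := fun h => hpe (h ▸ hu)
        simp [hμ, this]
    have hzero : ∀ e ∈ edgeFinset P, cE μ' e = 0 := by
      intro e he
      rw [hcE']
      by_cases heG : e ⊆ G
      · rw [hK e he heG, zero_add]
        apply Finset.sum_eq_zero
        intro e0 he0
        rw [hD e0 e he, if_neg, mul_zero]
        rintro rfl
        exact (Finset.mem_filter.1 he0).2 heG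
      · rw [Finset.sum_eq_single e]
        · rw [hD e e he, if_pos rfl]; ring
        · intro b _ hb
          rw [hD b e he, if_neg hb.symm, mul_zero]
        · intro h
          exact absurd (Finset.mem_filter.2 ⟨he, heG⟩) h
    have hDpq : ∀ e0 ∈ S, cE (D e0) {p, q} = 0 := by
      intro e0 he0
      obtain ⟨he0, heG⟩ := Finset.mem_filter.1 he0
      obtain ⟨x, hx, hxG⟩ := Finset.not_subset.1 heG
      rw [hGdef, Finset.mem_insert, Finset.mem_insert] at hxG
      push Not at hxG
      obtain ⟨hxq, hxp, hxR⟩ := hxG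
      have hxV : x ∈ P.V := (mem_edge.1 he0).2.1 hx
      have hex : ∃ r ∈ R, ¬ BFace P {x, r} := by
        by_contra hall
        push Not at hall
        have hb : BFace P (insert x R) := by
          apply P.clique_face' (by omega) h0 hno
          · rw [Finset.card_insert_of_notMem hxR]; omega
          · intro y hy
            rw [Finset.mem_insert] at hy
            rcases hy with rfl | hy
            · exact hxV
            · exact hF.1.1 (by simp [hy])
          · intro u hu v hv huv
            rw [Finset.mem_insert] at hu hv
            rcases hu with rfl | hu <;> rcases hv with rfl | hv
            · exact absurd rfl huv
            · exact hall v hv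
            · rw [Finset.pair_comm]; exact hall u hu
            · exact pairP _ (by simp [hu]) _ (by simp [hv])
        have := hsc.ridge_unique hpR hqR hpq hF hQ hxR ⟨(P.bface_iff_Fc _).1 hb, by
          rw [Finset.card_insert_of_notMem hxR]; omega⟩
        rcases this with h | h
        · exact hxp h
        · exact hxq h
      obtain ⟨r, hrR, hr⟩ := hex
      obtain ⟨τ, h1, h2, h3⟩ := Finset.exists_subsuperset_card_eq (n := d - 3)
        (Finset.singleton_subset_iff.2 hrR) (by simp; omega) (by omega)
      rw [cE_pair _ hpq]
      apply hsc.thmA hpR hqR hpq hF hQ h2 (by omega) h3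
      apply mo_cond
      intro e he hb
      rw [hD e0 e he, if_neg]
      rintro rfl
      apply hr
      apply hb.mono
      intro y hy
      rw [Finset.mem_insert, Finset.mem_singleton] at hy
      rw [Finset.mem_union]
      rcases hy with rfl | rfl
      · exact Or.inl hx
      · exact Or.inr (h1 (by simp))
    obtain ⟨B, Ba, Bm⟩ := P.rigid (by omega) μ' hzero
    have h1 : cE μ' {p, q} = 0 := by rw [cE_pair _ hpq, Bm p hpV, Bm q hqV, Ba]
    rw [hcE', hμpq, Finset.sum_eq_zero (fun e0 he0 => by rw [hDpq e0 he0, mul_zero])] at h1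
    norm_num at h1


lemma hull_le {d : ℕ} {S : Set (Fin d → ℝ)} {g : (Fin d → ℝ) →ₗ[ℝ] ℝ} {e : ℝ}
    (h : ∀ v ∈ S, g v ≤ e) {y : Fin d → ℝ} (hy : y ∈ convexHull ℝ S) : g y ≤ e := by
  have : convexHull ℝ S ⊆ {x | g x ≤ e} :=
    convexHull_min (fun v hv => h v hv) (convex_halfSpace_le g.isLinear e)
  exact this hy

lemma hull_lt {d : ℕ} {S : Set (Fin d → ℝ)} {g : (Fin d → ℝ) →ₗ[ℝ] ℝ} {e : ℝ}
    (h : ∀ v ∈ S, g v < e) {y : Fin d → ℝ} (hy : y ∈ convexHull ℝ S) : g y < e := by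
  have : convexHull ℝ S ⊆ {x | g x < e} :=
    convexHull_min (fun v hv => h v hv) (convex_halfSpace_lt g.isLinear e)
  exact this hy

lemma hull_eq {d : ℕ} {S : Set (Fin d → ℝ)} {g : (Fin d → ℝ) →ₗ[ℝ] ℝ} {e : ℝ}
    (h : ∀ v ∈ S, g v = e) {y : Fin d → ℝ} (hy : y ∈ convexHull ℝ S) : g y = e := by
  apply le_antisymm (hull_le (fun v hv => (h v hv).le) hy)
  have := hull_le (g := -g) (e := -e) (fun v hv => by simp [h v hv]) hy
  simpa using this

lemma face_hull {d : ℕ} {V : Finset (Fin d → ℝ)} {g : (Fin d → ℝ) →ₗ[ℝ] ℝ} {e : ℝ}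
    (h : ∀ v ∈ V, g v ≤ e) {y : Fin d → ℝ} (hy : y ∈ polyBody V) (hge : g y = e) :
    y ∈ convexHull ℝ ((V.filter (fun v => g v = e) : Finset (Fin d → ℝ)) : Set (Fin d → ℝ)) := by
  rw [polyBody, Finset.mem_convexHull'] at hy
  obtain ⟨w, w0, w1, wy⟩ := hy
  have hs : ∑ v ∈ V, w v * (e - g v) = 0 := by
    have h1 : g y = ∑ v ∈ V, w v * g v := by rw [← wy, map_sum]; simp
    simp only [mul_sub]
    rw [Finset.sum_sub_distrib, ← Finset.sum_mul, w1, ← h1, hge]; ring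
  have hz : ∀ v ∈ V, w v * (e - g v) = 0 :=
    (Finset.sum_eq_zero_iff_of_nonneg (fun v hv => mul_nonneg (w0 v hv)
      (by linarith [h v hv]))).1 hs
  have hz' : ∀ v ∈ V, v ∉ V.filter (fun v => g v = e) → w v = 0 := by
    intro v hv hn
    rcases mul_eq_zero.1 (hz v hv) with h1 | h1
    · exact h1
    · exact absurd (Finset.mem_filter.2 ⟨hv, by linarith⟩) hn
  rw [Finset.mem_convexHull']
  refine ⟨w, fun v hv => w0 v (Finset.mem_filter.1 hv).1, ?_, ?_⟩
  · rw [← w1]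
    exact Finset.sum_subset (Finset.filter_subset _ _) hz'
  · rw [← wy]
    exact Finset.sum_subset (Finset.filter_subset _ _) (fun v hv hn => by rw [hz' v hv hn, zero_smul])

/-- Data of a missing facet and its hyperplane. -/
structure CD {d : ℕ} (P : SPolytope d) (σ : Finset (Fin d → ℝ)) (f : (Fin d → ℝ) →ₗ[ℝ] ℝ)
    (c : ℝ) : Prop where
  miss : IsMissingFace P σ
  card : σ.card = d
  body : ∀ x ∈ polyBody P.V, f x = c → x ∈ convexHull ℝ (σ : Set (Fin d → ℝ))
  on : ∀ v ∈ P.V, (f v = c ↔ v ∈ σ)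
  lo : ∃ v ∈ P.V, f v < c
  hi : ∃ v ∈ P.V, c < f v
  li : LinearIndepOn ℝ hw (σ : Set (Fin d → ℝ))
  uniq : ∀ (f' : (Fin d → ℝ) →ₗ[ℝ] ℝ) (c' : ℝ), (∀ v ∈ σ, f' v = c') → ∃ t : ℝ, f' = t • f ∧ c' = t * c

lemma CD.neg {d : ℕ} {P : SPolytope d} {σ : Finset (Fin d → ℝ)} {f : (Fin d → ℝ) →ₗ[ℝ] ℝ}
    {c : ℝ} (h : CD P σ f c) : CD P σ (-f) (-c) where
  miss := h.miss
  card := h.card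
  body := fun x hx hc => h.body x hx (by simpa using hc)
  on := fun v hv => by simpa using h.on v hv
  lo := by simpa using h.hi
  hi := by simpa using h.lo
  li := h.li
  uniq := by
    intro f' c' hv
    obtain ⟨t, h1, h2⟩ := h.uniq f' c' hv
    exact ⟨-t, by rw [h1]; simp, by rw [h2]; ring⟩

lemma IsMissingFace.dual {d : ℕ} (hd : 1 ≤ d) {P : SPolytope d} {σ : Finset (Fin d → ℝ)}
    (hm : IsMissingFace P σ) : ∀ p ∈ σ, ∃ ℓ : Module.Dual ℝ ((Fin d → ℝ) × ℝ),
      (∀ v ∈ σ, v ≠ p → ℓ (hw v) = 0) ∧ (∀ v ∈ P.V, 0 ≤ ℓ (hw v)) ∧ 0 < ℓ (hw p) := by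
  intro p hp
  have hb := hm.2.2 _ (Finset.erase_ssubset hp)
  obtain ⟨ℓ, h1, h2⟩ := (P.sc hd).exact ((P.bface_iff_Fc _).1 hb)
  refine ⟨ℓ, fun v hv hvp => h1 v (Finset.mem_erase.2 ⟨hvp, hv⟩), ?_, h2 p (hm.1 hp) (by simp)⟩
  intro v hv
  by_cases hve : v ∈ σ.erase p
  · rw [h1 v hve]
  · exact (h2 v hv hve).le

lemma IsMissingFace.li {d : ℕ} (hd : 1 ≤ d) {P : SPolytope d} {σ : Finset (Fin d → ℝ)}
    (hm : IsMissingFace P σ) : LinearIndependent ℝ (fun x : {x // x ∈ σ} => hw (x : Fin d → ℝ)) := by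
  rw [Fintype.linearIndependent_iff]
  intro g hg p
  obtain ⟨ℓ, h1, -, h3⟩ := hm.dual hd p.1 p.2
  have := congrArg ℓ hg
  rw [map_sum, map_zero, Finset.sum_eq_single p] at this
  · rw [map_smul, smul_eq_mul] at this
    exact (mul_eq_zero.1 this).resolve_right h3.ne'
  · intro q _ hq
    rw [map_smul, h1 q.1 q.2 (fun h => hq (Subtype.ext h)), smul_zero]
  · intro h; exact absurd (Finset.mem_univ _) h

lemma IsMissingFace.cd {d : ℕ} (hd : 1 ≤ d) {P : SPolytope d} {σ : Finset (Fin d → ℝ)}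
    (hm : IsMissingFace P σ) (hc : σ.card = d) {f : (Fin d → ℝ) →ₗ[ℝ] ℝ} {c : ℝ}
    (h0 : f ≠ 0) (hf : ∀ v ∈ σ, f v = c) : CD P σ f c := by
  have hl0 : mkl f c ≠ 0 := fun h => h0 (mkl_eq_zero h).1
  have hli := hm.li hd
  have hker : Submodule.span ℝ (Set.range (fun x : {x // x ∈ σ} => hw (x : Fin d → ℝ)))
      = LinearMap.ker (mkl f c) := by
    apply Submodule.eq_of_le_of_finrank_eq
    · rw [Submodule.span_le]
      rintro _ ⟨x, rfl⟩
      simp only [SetLike.mem_coe, LinearMap.mem_ker, mkl_hw]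
      rw [hf x.1 x.2, sub_self]
    · rw [finrank_span_eq_card hli]
      have := Module.Dual.finrank_ker_add_one_of_ne_zero hl0
      simp at this ⊢
      omega
  have hrep : ∀ y, f y = c → ∃ a : {x // x ∈ σ} → ℝ, ∑ x, a x • hw (x : Fin d → ℝ) = hw y := by
    intro y hy
    have : hw y ∈ LinearMap.ker (mkl f c) := by
      rw [LinearMap.mem_ker, mkl_hw, hy, sub_self]
    rw [← hker, Submodule.mem_span_range_iff_exists_fun] at this
    exact this
  have hbody : ∀ x ∈ polyBody P.V, f x = c → x ∈ convexHull ℝ (σ : Set (Fin d → ℝ)) := by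
    intro y hy hyc
    obtain ⟨a, ha⟩ := hrep y hyc
    have hpos : ∀ p, 0 ≤ a p := by
      intro p
      obtain ⟨ℓ, h1, h2, h3⟩ := hm.dual hd p.1 p.2
      have hly : 0 ≤ ℓ (hw y) := by
        obtain ⟨g, e, rfl⟩ := exists_mkl ℓ
        rw [mkl_hw]
        have := body_le (V := P.V) (f := g) (c := e) (fun v hv => by
          have := h2 v hv; rw [mkl_hw] at this; linarith) y hy
        linarith
      rw [← ha, map_sum, Finset.sum_eq_single p] at hly
      · rw [map_smul, smul_eq_mul] at hly
        exact nonneg_of_mul_nonneg_left hly h3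
      · intro q _ hq
        rw [map_smul, h1 q.1 q.2 (fun h => hq (Subtype.ext h)), smul_zero]
      · intro h; exact absurd (Finset.mem_univ _) h
    have hs1 : ∑ x, a x = 1 := by
      have := congrArg Prod.snd ha
      simpa [hw, Prod.snd_sum] using this
    have hs2 : ∑ x, a x • (x : Fin d → ℝ) = y := by
      have := congrArg Prod.fst ha
      simpa [hw, Prod.fst_sum] using this
    rw [← hs2]
    exact (convex_convexHull ℝ _).sum_mem (fun i _ => hpos i) hs1
      (fun i _ => subset_convexHull ℝ _ i.2)
  have hne : ∃ v ∈ P.V, f v ≠ c := by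
    by_contra hcon
    push Not at hcon
    exact h0 (P.const_zero hcon).1
  refine ⟨hm, hc, hbody, ?_, ?_, ?_, hli, ?_⟩
  · intro v hv
    refine ⟨fun h => ?_, hf v⟩
    by_contra hn
    apply P.extreme v hv
    refine convexHull_mono ?_ (hbody v (mem_body hv) h)
    intro x hx
    exact Finset.mem_coe.2 (Finset.mem_erase.2 ⟨fun h => hn (h ▸ hx), hm.1 hx⟩)
  · by_contra hcon
    push Not at hcon
    apply hm.2.1
    rw [P.bface_iff]
    obtain ⟨v, hv, hvc⟩ := hne
    exact ⟨hm.1, -f, -c, fun v hv => by simpa using hcon v hv, ⟨v, hv, by simpa using hvc⟩,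
      fun v hv => by simp [hf v hv]⟩
  · by_contra hcon
    push Not at hcon
    apply hm.2.1
    rw [P.bface_iff]
    exact ⟨hm.1, f, c, hcon, hne, hf⟩
  · intro f' c' h'
    have hk' : LinearMap.ker (mkl f c) ≤ LinearMap.ker (mkl f' c') := by
      rw [← hker, Submodule.span_le]
      rintro _ ⟨x, rfl⟩
      simp only [SetLike.mem_coe, LinearMap.mem_ker, mkl_hw]
      rw [h' x.1 x.2, sub_self]
    obtain ⟨z, hz⟩ : ∃ z, mkl f c z ≠ 0 := by
      by_contra hcon
      push Not at hcon
      exact hl0 (LinearMap.ext hcon)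
    have hall : ∀ y, mkl f' c' y = (mkl f' c' z / mkl f c z) * mkl f c y := by
      intro y
      have : y - (mkl f c y / mkl f c z) • z ∈ LinearMap.ker (mkl f c) := by
        rw [LinearMap.mem_ker, map_sub, map_smul, smul_eq_mul, div_mul_cancel₀ _ hz, sub_self]
      have := hk' this
      rw [LinearMap.mem_ker, map_sub, map_smul, smul_eq_mul] at this
      field_simp at this ⊢
      linarith
    generalize mkl f' c' z / mkl f c z = t at hall
    refine ⟨t, ?_, ?_⟩
    · apply LinearMap.ext
      intro x
      have := hall (x, 0)
      rw [mkl_apply, mkl_apply] at this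
      rw [LinearMap.smul_apply, smul_eq_mul]
      linarith
    · have := hall (0, 1)
      rw [mkl_apply, mkl_apply] at this
      simpa using this

lemma IsMissingFace.exists_cd {d : ℕ} (hd : 1 ≤ d) {P : SPolytope d} {σ : Finset (Fin d → ℝ)}
    (hm : IsMissingFace P σ) (hc : σ.card = d) : ∃ f c, CD P σ f c := by
  have hlt : Submodule.span ℝ (Set.range (fun x : {x // x ∈ σ} => hw (x : Fin d → ℝ))) < ⊤ := by
    apply Submodule.lt_top_of_finrank_lt_finrank
    rw [finrank_span_eq_card (hm.li hd)]
    simp [hc]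
  obtain ⟨ℓ, h0, hℓ⟩ := Submodule.exists_le_ker_of_lt_top _ hlt
  obtain ⟨f, c, rfl⟩ := exists_mkl ℓ
  have hf : ∀ v ∈ σ, f v = c := by
    intro v hv
    have : mkl f c (hw v) = 0 := hℓ (Submodule.subset_span ⟨⟨v, hv⟩, rfl⟩)
    rw [mkl_hw] at this; linarith
  refine ⟨f, c, hm.cd hd hc ?_ hf⟩
  rintro rfl
  obtain ⟨v, hv⟩ : σ.Nonempty := by rw [← Finset.card_pos]; omega
  have : c = 0 := by rw [← hf v hv]; rfl
  subst this
  exact h0 mkl_zero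

section cut
variable {d : ℕ} {P : SPolytope d} {σ : Finset (Fin d → ℝ)} {f : (Fin d → ℝ) →ₗ[ℝ] ℝ} {c : ℝ}

lemma CD.cross (h : CD P σ f c) {x u : Fin d → ℝ} (hx : x ∈ polyBody P.V) (hu : u ∈ polyBody P.V)
    (hxc : c ≤ f x) (huc : f u < c) : ∃ r : ℝ, 0 ≤ r ∧ r ≤ 1 ∧ (c < f x → 0 < r) ∧
      (1 - r) • x + r • u ∈ convexHull ℝ (σ : Set (Fin d → ℝ)) := by
  have hpos : 0 < f x - f u := by linarith
  refine ⟨(f x - c) / (f x - f u), div_nonneg (by linarith) hpos.le, ?_, ?_, ?_⟩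
  · rw [div_le_one hpos]; linarith
  · intro hh; exact div_pos (by linarith) hpos
  · apply h.body
    · apply (convex_convexHull ℝ _) hx hu
      · rw [sub_nonneg, div_le_one hpos]; linarith
      · exact div_nonneg (by linarith) hpos.le
      · ring
    · rw [map_add, map_smul, map_smul, smul_eq_mul, smul_eq_mul]
      field_simp
      ring

lemma CD.ext_le (h : CD P σ f c) {g : (Fin d → ℝ) →ₗ[ℝ] ℝ} {e : ℝ} (hg : ∀ v ∈ σ, g v ≤ e)
    {p : Fin d → ℝ} (hp : p ∈ P.V) (hpc : c < f p) (hpe : g p = e) {u : Fin d → ℝ} (hu : u ∈ P.V)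
    (huc : f u < c) : g u ≤ e := by
  obtain ⟨r, r0, r1, r2, hz⟩ := h.cross (mem_body hp) (mem_body hu) hpc.le huc
  have := hull_le hg hz
  rw [map_add, map_smul, map_smul, smul_eq_mul, smul_eq_mul, hpe] at this
  have hr := r2 hpc
  have h3 : r * (g u) ≤ r * e := by linarith
  exact le_of_mul_le_mul_left h3 hr

lemma CD.no_cross (h : CD P σ f c) (hd : 1 ≤ d) {u v : Fin d → ℝ} (hb : BFace P {u, v})
    (hu : f u < c) (hv : c < f v) : False := by
  obtain ⟨ℓ, h1, h2⟩ := (P.sc hd).exact ((P.bface_iff_Fc _).1 hb)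
  obtain ⟨g, e, rfl⟩ := exists_mkl ℓ
  obtain ⟨r, r0, r1, r2, hz⟩ := h.cross (mem_body (hb.1 (by simp))) (mem_body (hb.1 (by simp)))
    hv.le hu
  have e1 := h1 u (by simp)
  have e2 := h1 v (by simp)
  rw [mkl_hw] at e1 e2
  have := hull_lt (g := g) (e := e) (fun x hx => by
    have hxV := h.miss.1 hx
    have hxc := (h.on x hxV).2 hx
    have := h2 x hxV (by
      rw [Finset.mem_insert, Finset.mem_singleton]
      rintro (rfl | rfl) <;> linarith)
    rw [mkl_hw] at this
    linarith) hz
  rw [map_add, map_smul, map_smul, smul_eq_mul, smul_eq_mul] at this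
  have e3 : g u = e := by linarith
  have e4 : g v = e := by linarith
  rw [e3, e4] at this
  linarith

lemma CD.ext_le' (h : CD P σ f c) {g : (Fin d → ℝ) →ₗ[ℝ] ℝ} {e : ℝ}
    (hg : ∀ v ∈ P.V.filter (fun v => c ≤ f v), g v ≤ e)
    {p : Fin d → ℝ} (hp : p ∈ P.V) (hpc : c < f p) (hpe : g p = e) : ∀ u ∈ P.V, g u ≤ e := by
  intro u hu
  by_cases huc : c ≤ f u
  · exact hg u (Finset.mem_filter.2 ⟨hu, huc⟩)
  · refine h.ext_le (fun v hv => hg v (Finset.mem_filter.2 ⟨h.miss.1 hv, ?_⟩)) hp hpc hpe hu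
      (not_le.1 huc)
    exact ((h.on v (h.miss.1 hv)).2 hv).ge

lemma CD.sub (h : CD P σ f c) : σ ⊆ P.V.filter (fun v => c ≤ f v) := fun v hv =>
  Finset.mem_filter.2 ⟨h.miss.1 hv, ((h.on v (h.miss.1 hv)).2 hv).ge⟩

lemma CD.span (h : CD P σ f c) : affineSpan ℝ
    ((P.V.filter (fun v => c ≤ f v) : Finset (Fin d → ℝ)) : Set (Fin d → ℝ)) = ⊤ := by
  obtain ⟨v, hv, hvc⟩ := h.hi
  have hvσ : v ∉ σ := fun hh => by
    have := (h.on v hv).2 hh; linarith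
  have hli : LinearIndepOn ℝ hw ((insert v σ : Finset (Fin d → ℝ)) : Set (Fin d → ℝ)) := by
    rw [Finset.coe_insert, linearIndepOn_insert (by simpa using hvσ)]
    refine ⟨h.li, fun hmem => ?_⟩
    have : Submodule.span ℝ (hw '' (σ : Set (Fin d → ℝ))) ≤ LinearMap.ker (mkl f c) := by
      rw [Submodule.span_le]
      rintro _ ⟨x, hx, rfl⟩
      simp only [SetLike.mem_coe, LinearMap.mem_ker, mkl_hw]
      rw [(h.on x (h.miss.1 hx)).2 hx, sub_self]
    have := this hmem
    rw [LinearMap.mem_ker, mkl_hw] at this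
    linarith
  have hai : AffineIndependent ℝ (fun x : ((insert v σ : Finset (Fin d → ℝ)) : Set (Fin d → ℝ)) =>
    (x : Fin d → ℝ)) := affInd_of_hw hli
  have htop := (hai.affineSpan_eq_top_iff_card_eq_finrank_add_one).2 (by
    simp [Finset.card_insert_of_notMem hvσ, h.card])
  rw [Subtype.range_coe] at htop
  rw [eq_top_iff, ← htop]
  apply affineSpan_mono
  intro x hx
  rw [Finset.mem_coe, Finset.mem_insert] at hx
  rcases hx with rfl | hx
  · exact Finset.mem_coe.2 (Finset.mem_filter.2 ⟨hv, hvc.le⟩)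
  · exact Finset.mem_coe.2 (h.sub hx)

lemma CD.body_eq (h : CD P σ f c) :
    polyBody (P.V.filter (fun v => c ≤ f v)) = {x ∈ polyBody P.V | c ≤ f x} := by
  ext y
  constructor
  · intro hy
    refine ⟨convexHull_mono (Finset.coe_subset.2 (Finset.filter_subset _ _)) hy, ?_⟩
    have := hull_le (g := -f) (e := -c) (fun v hv => by
      have := (Finset.mem_filter.1 (Finset.mem_coe.1 hv)).2
      simpa using this) hy
    simpa using this
  · rintro ⟨hy, hyc⟩
    by_contra hn
    obtain ⟨g, hg⟩ := exists_sep _ hn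
    have : ∀ u ∈ P.V, g u < g y := by
      intro u hu
      by_cases huc : c ≤ f u
      · exact hg u (Finset.mem_filter.2 ⟨hu, huc⟩)
      · by_contra hle
        push Not at hle
        obtain ⟨r, r0, r1, r2, hz⟩ := h.cross hy (mem_body hu) hyc (not_le.1 huc)
        have := hull_lt (fun v hv => hg v (h.sub hv)) hz
        rw [map_add, map_smul, map_smul, smul_eq_mul, smul_eq_mul] at this
        nlinarith
    exact lt_irrefl _ (hull_lt this hy)

/-- The upper part of the polytope. -/
def CD.up (h : CD P σ f c) (hd : 1 ≤ d) : SPolytope d where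
  V := P.V.filter (fun v => c ≤ f v)
  span_top := h.span
  extreme := by
    intro v hv hmem
    apply P.extreme v (Finset.mem_filter.1 hv).1
    exact convexHull_mono (Finset.coe_subset.2 (Finset.erase_subset_erase _ (Finset.filter_subset _ _))) hmem
  simplicial := by
    rintro F ⟨⟨g, e, hsup⟩, hne⟩
    have hle : ∀ v ∈ P.V.filter (fun v => c ≤ f v), g v ≤ e := fun v hv => hsup.1 v (mem_body hv)
    have hF : (((P.V.filter (fun v => c ≤ f v) : Finset (Fin d → ℝ)) : Set (Fin d → ℝ)) ∩ F) =
        (((P.V.filter (fun v => c ≤ f v)).filter (fun v => g v = e) : Finset (Fin d → ℝ)) :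
          Set (Fin d → ℝ)) := by
      ext x
      rw [hsup.2, Set.mem_inter_iff, Finset.mem_coe, Finset.mem_coe, Finset.mem_filter (p := fun v => g v = e)]
      constructor
      · exact fun hh => ⟨hh.1, hh.2.2⟩
      · exact fun hh => ⟨hh.1, mem_body hh.1, hh.2⟩
    rw [hF]
    constructor
    · apply affInd_of_hw
      by_cases hs : (P.V.filter (fun v => c ≤ f v)).filter (fun v => g v = e) ⊆ σ
      · exact LinearIndepOn.mono h.li (Finset.coe_subset.2 hs)
      · obtain ⟨p, hp, hpσ⟩ := Finset.not_subset.1 hs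
        have hp' := Finset.mem_filter.1 hp
        have hp'' := Finset.mem_filter.1 hp'.1
        have hpc : c < f p := lt_of_le_of_ne hp''.2 (fun hh => hpσ ((h.on p hp''.1).1 hh.symm))
        have hall := h.ext_le' hle hp''.1 hpc hp'.2
        obtain ⟨v, hv, hvc⟩ := properFace_ne hsup hne
        have hb : BFace P ((P.V.filter (fun v => c ≤ f v)).filter (fun v => g v = e)) := by
          rw [P.bface_iff]
          exact ⟨(Finset.filter_subset _ _).trans (Finset.filter_subset _ _), g, e, hall,
            ⟨v, (Finset.mem_filter.1 hv).1, hvc⟩, fun v hv => (Finset.mem_filter.1 hv).2⟩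
        exact (P.sc hd).li ((P.bface_iff_Fc _).1 hb)
    · apply Set.Subset.antisymm
      · intro y hy
        rw [hsup.2] at hy
        exact face_hull hle hy.1 hy.2
      · rw [hsup.2]
        intro y hy
        refine ⟨convexHull_mono (Finset.coe_subset.2 (Finset.filter_subset _ _)) hy, ?_⟩
        exact hull_eq (fun v hv => (Finset.mem_filter.1 (Finset.mem_coe.1 hv)).2) hy

lemma CD.up_V (h : CD P σ f c) (hd : 1 ≤ d) : (h.up hd).V = P.V.filter (fun v => c ≤ f v) := rfl

lemma CD.up_bface (h : CD P σ f c) (hd : 1 ≤ d) (s : Finset (Fin d → ℝ)) :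
    BFace (h.up hd) s ↔ s ⊆ (h.up hd).V ∧ (BFace P s ∨ s ⊆ σ) := by
  constructor
  · intro hs
    refine ⟨hs.1, ?_⟩
    rw [SPolytope.bface_iff] at hs
    obtain ⟨h1, g, e, h2, ⟨v, hv, hvc⟩, h4⟩ := hs
    by_cases hsσ : s ⊆ σ
    · exact Or.inr hsσ
    · left
      obtain ⟨p, hp, hpσ⟩ := Finset.not_subset.1 hsσ
      have hp'' := Finset.mem_filter.1 (h1 hp)
      have hpc : c < f p := lt_of_le_of_ne hp''.2 (fun hh => hpσ ((h.on p hp''.1).1 hh.symm))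
      rw [P.bface_iff]
      exact ⟨h1.trans (Finset.filter_subset _ _), g, e, h.ext_le' h2 hp''.1 hpc (h4 p hp),
        ⟨v, (Finset.mem_filter.1 hv).1, hvc⟩, h4⟩
  · rintro ⟨h1, h2 | h2⟩
    · rw [SPolytope.bface_iff] at h2 ⊢
      obtain ⟨h3, g, e, h4, ⟨v, hv, hvc⟩, h6⟩ := h2
      refine ⟨h1, g, e, fun v hv => h4 v (Finset.mem_filter.1 hv).1, ?_, h6⟩
      by_contra hcon
      push Not at hcon
      obtain ⟨rfl, rfl⟩ := (h.up hd).const_zero hcon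
      exact hvc rfl
    · rw [SPolytope.bface_iff]
      obtain ⟨v, hv, hvc⟩ := h.hi
      refine ⟨h1, -f, -c, ?_, ⟨v, Finset.mem_filter.2 ⟨hv, hvc.le⟩, ?_⟩, ?_⟩
      · intro v hv
        have := (Finset.mem_filter.1 hv).2
        simpa using this
      · simpa using hvc.ne'
      · intro v hv
        simp [(h.on v (h.miss.1 (h2 hv))).2 (h2 hv)]

lemma CD.pair (h : CD P σ f c) (hd : 3 ≤ d) {s : Finset (Fin d → ℝ)} (hs : s ⊆ σ)
    (hc : s.card < d) : BFace P s := by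
  apply h.miss.2.2
  refine Finset.ssubset_iff_subset_ne.2 ⟨hs, ?_⟩
  rintro rfl
  rw [h.card] at hc
  omega

lemma CD.up_edge (h : CD P σ f c) (hd : 3 ≤ d) :
    edgeFinset (h.up (by omega)) = (edgeFinset P).filter (fun e => e ⊆ (h.up (by omega)).V) := by
  ext e
  rw [Finset.mem_filter, mem_edge, mem_edge, h.up_bface]
  constructor
  · rintro ⟨h1, h2, h3 | h3⟩
    · exact ⟨⟨h1, h3⟩, h2⟩
    · exact ⟨⟨h1, h.pair hd h3 (by omega)⟩, h2⟩
  · rintro ⟨⟨h1, h2⟩, h3⟩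
    exact ⟨h1, h3, Or.inl h2⟩

lemma CD.g2_add (h : CD P σ f c) (hd : 3 ≤ d) :
    g2 P = g2 (h.up (by omega)) + g2 (h.neg.up (by omega)) := by
  have hU : (h.up (by omega)).V ∪ (h.neg.up (by omega)).V = P.V := by
    ext v
    simp only [CD.up_V, Finset.mem_union, Finset.mem_filter, LinearMap.neg_apply, neg_le_neg_iff]
    constructor
    · rintro (h | h) <;> exact h.1
    · intro hv
      rcases le_total c (f v) with h | h
      · exact Or.inl ⟨hv, h⟩
      · exact Or.inr ⟨hv, h⟩
  have hI : (h.up (by omega)).V ∩ (h.neg.up (by omega)).V = σ := by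
    ext v
    simp only [CD.up_V, Finset.mem_inter, Finset.mem_filter, LinearMap.neg_apply, neg_le_neg_iff]
    constructor
    · rintro ⟨⟨h1, h2⟩, h3, h4⟩
      exact (h.on v h1).1 (le_antisymm h4 h2)
    · intro hv
      have h1 := h.miss.1 hv
      have h2 := (h.on v h1).2 hv
      exact ⟨⟨h1, h2.ge⟩, h1, h2.le⟩
  have k0 := Finset.card_union_add_card_inter (h.up (by omega)).V (h.neg.up (by omega)).V
  rw [hU, hI, h.card] at k0
  have hEU : edgeFinset (h.up (by omega)) ∪ edgeFinset (h.neg.up (by omega)) = edgeFinset P := by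
    rw [h.up_edge hd, h.neg.up_edge hd]
    ext e
    rw [Finset.mem_union, Finset.mem_filter, Finset.mem_filter]
    constructor
    · rintro (h | h) <;> exact h.1
    · intro he
      by_contra hcon
      push Not at hcon
      obtain ⟨c1, c2⟩ := hcon
      obtain ⟨u, hu, hu'⟩ := Finset.not_subset.1 (c1 he)
      obtain ⟨v, hv, hv'⟩ := Finset.not_subset.1 (c2 he)
      have hb := (mem_edge.1 he).2
      simp only [CD.up_V, Finset.mem_filter, not_and, not_le, LinearMap.neg_apply, neg_lt_neg_iff] at hu' hv'
      refine h.no_cross (by omega) (u := u) (v := v) (hb.mono ?_) (hu' (hb.1 hu)) (hv' (hb.1 hv))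
      intro x hx
      rw [Finset.mem_insert, Finset.mem_singleton] at hx
      rcases hx with rfl | rfl <;> assumption
  have hEI : edgeFinset (h.up (by omega)) ∩ edgeFinset (h.neg.up (by omega)) = σ.powersetCard 2 := by
    rw [h.up_edge hd, h.neg.up_edge hd]
    ext e
    rw [Finset.mem_inter, Finset.mem_filter, Finset.mem_filter, Finset.mem_powersetCard, mem_edge]
    constructor
    · rintro ⟨⟨⟨h1, h2⟩, h3⟩, -, h4⟩
      exact ⟨hI ▸ Finset.subset_inter h3 h4, h1⟩
    · rintro ⟨h1, h2⟩
      have h3 := h.pair hd h1 (by omega)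
      rw [← hI] at h1
      exact ⟨⟨⟨h2, h3⟩, h1.trans Finset.inter_subset_left⟩, ⟨h2, h3⟩, h1.trans Finset.inter_subset_right⟩
  have k1 := Finset.card_union_add_card_inter (edgeFinset (h.up (by omega)))
    (edgeFinset (h.neg.up (by omega)))
  rw [hEU, hEI, Finset.card_powersetCard, h.card] at k1
  have k2 : d.choose 2 + (d + 1).choose 2 = d * d := by
    have h1 := Nat.choose_two_right d
    have h2 : (d + 1).choose 2 = d.choose 1 + d.choose 2 := Nat.choose_succ_succ d 1
    have h3 : 2 * d.choose 2 = d * (d - 1) := by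
      rw [h1]; exact Nat.mul_div_cancel' (Nat.even_mul_pred_self d).two_dvd
    rw [h2, Nat.choose_one_right]
    obtain ⟨k, rfl⟩ : ∃ k, d = k + 1 := ⟨d - 1, by omega⟩
    simp only [Nat.add_sub_cancel] at h3
    nlinarith
  simp only [g2, f1, f0]
  zify at k0 k1 k2
  linear_combination k1 - (d : ℤ) * k0 - k2

end cut


lemma SPolytope.facet_of {d : ℕ} (Q : SPolytope d) {σ : Finset (Fin d → ℝ)}
    {f : (Fin d → ℝ) →ₗ[ℝ] ℝ} {c : ℝ} (hle : ∀ v ∈ Q.V, f v ≤ c) (hne : ∃ v ∈ Q.V, f v ≠ c)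
    (hσ : ∀ v, (v ∈ Q.V ∧ f v = c) ↔ v ∈ σ) (hc : σ.card = d) :
    IsFacet Q (convexHull ℝ (σ : Set (Fin d → ℝ))) ∧
      convexHull ℝ (σ : Set (Fin d → ℝ)) = {y ∈ polyBody Q.V | f y = c} := by
  have hp := Q.face_of hle hne
  have hI : (Q.V : Set (Fin d → ℝ)) ∩ {y ∈ polyBody Q.V | f y = c} = (σ : Set (Fin d → ℝ)) := by
    ext v
    rw [Finset.mem_coe, ← hσ]
    constructor
    · exact fun h => ⟨h.1, h.2.2⟩
    · exact fun h => ⟨h.1, mem_body h.1, h.2⟩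
  have he := (Q.simplicial _ hp).2
  rw [hI] at he
  refine ⟨⟨?_, ?_⟩, he.symm⟩
  · rw [← he]; exact hp
  · rw [← he, hI, Set.ncard_coe_finset, hc]

lemma IsStacked.step {d : ℕ} {R P : SPolytope d} (hR : IsStacked R) {v : Fin d → ℝ}
    (h1 : BeyondExactlyOne R v) (h2 : polyBody P.V = convexHull ℝ (polyBody R.V ∪ {v})) :
    IsStacked P := by
  obtain ⟨m, S, s0, s1, s2⟩ := hR
  refine ⟨m + 1, Fin.snoc (α := fun _ => SPolytope d) S P, ?_, ?_, ?_⟩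
  · have : (Fin.snoc (α := fun _ => SPolytope d) S P) 0 = S 0 := by
      exact Fin.snoc_castSucc (α := fun _ => SPolytope d) (x := P) (p := S) 0
    rw [this]; exact s0
  · exact Fin.snoc_last _ _
  · intro k
    refine Fin.lastCases ?_ (fun k => ?_) k
    · refine ⟨v, ?_, ?_⟩
      · rw [Fin.snoc_castSucc, s1]; exact h1
      · rw [Fin.snoc_castSucc, s1, Fin.succ_last, Fin.snoc_last]; exact h2
    · obtain ⟨w, w1, w2⟩ := s2 k
      refine ⟨w, ?_, ?_⟩
      · rw [Fin.snoc_castSucc]; exact w1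
      · rw [Fin.snoc_castSucc, Fin.succ_castSucc, Fin.snoc_castSucc]; exact w2

section cut
variable {d : ℕ} {P : SPolytope d} {σ : Finset (Fin d → ℝ)} {f : (Fin d → ℝ) →ₗ[ℝ] ℝ} {c : ℝ}

lemma CD.up_facet (h : CD P σ f c) (hd : 1 ≤ d) :
    IsFacet (h.up hd) (convexHull ℝ (σ : Set (Fin d → ℝ))) ∧
      convexHull ℝ (σ : Set (Fin d → ℝ)) = {y ∈ polyBody (h.up hd).V | (-f) y = -c} := by
  apply SPolytope.facet_of
  · intro v hv
    have := (Finset.mem_filter.1 hv).2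
    simpa using this
  · obtain ⟨v, hv, hvc⟩ := h.hi
    exact ⟨v, Finset.mem_filter.2 ⟨hv, hvc.le⟩, by simpa using hvc.ne'⟩
  · intro v
    rw [CD.up_V, Finset.mem_filter, LinearMap.neg_apply, neg_inj]
    constructor
    · exact fun hh => (h.on v hh.1.1).1 hh.2
    · intro hh
      have h1 := h.miss.1 hh
      have h2 := (h.on v h1).2 hh
      exact ⟨⟨h1, h2.ge⟩, h2⟩
  · exact h.card

/-- A vertex of `P` alone below the hyperplane is beyond exactly the facet `σ` of the upper part. -/
lemma CD.beyond (h : CD P σ f c) (hd : 1 ≤ d) {v : Fin d → ℝ} (hv : v ∈ P.V) (hvc : f v < c) :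
    BeyondExactlyOne (h.up hd) v ∨ ∃ w ∈ P.V, f w < c ∧ w ≠ v := by
  by_cases hw' : ∃ w ∈ P.V, f w < c ∧ w ≠ v
  · exact Or.inr hw'
  left
  refine ⟨_, (h.up_facet hd).1, ?_, ?_⟩
  · intro f' c' hsup
    have hσ : ∀ x ∈ σ, f' x = c' := by
      intro x hx
      have : x ∈ convexHull ℝ (σ : Set (Fin d → ℝ)) := subset_convexHull ℝ _ hx
      rw [hsup.2] at this
      exact this.2
    obtain ⟨w, hwV, hwc⟩ := properFace_ne hsup (h.up_facet hd).1.1.2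
    have hwle := hsup.1 w (mem_body hwV)
    obtain ⟨t, rfl, rfl⟩ := h.uniq f' c' hσ
    have hwf := (Finset.mem_filter.1 hwV).2
    simp only [LinearMap.smul_apply, smul_eq_mul] at hwc hwle ⊢
    have ht : t < 0 := by
      by_contra hcon
      push Not at hcon
      apply hwc
      nlinarith
    nlinarith
  · intro F' hF' hne f' c' hsup
    obtain ⟨S, hS⟩ : ∃ S : Finset (Fin d → ℝ), S = (h.up hd).V.filter (fun x => f' x = c') := ⟨_, rfl⟩
    have hSF : ((h.up hd).V : Set (Fin d → ℝ)) ∩ F' = (S : Set (Fin d → ℝ)) := by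
      ext x
      rw [hsup.2, hS, Finset.mem_coe, Finset.mem_filter]
      constructor
      · exact fun h => ⟨h.1, h.2.2⟩
      · exact fun h => ⟨h.1, mem_body h.1, h.2⟩
    have hSc : S.card = d := by
      have := hF'.2
      rwa [hSF, Set.ncard_coe_finset] at this
    have hle : ∀ x ∈ (h.up hd).V, f' x ≤ c' := fun x hx => hsup.1 x (mem_body hx)
    have hSσ : ¬ S ⊆ σ := by
      intro hsub
      have : S = σ := Finset.eq_of_subset_of_card_le hsub (by rw [hSc, h.card])
      apply hne
      have h2 := ((h.up hd).simplicial F' hF'.1).2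
      rw [hSF, this] at h2
      exact h2
    obtain ⟨p, hp, hpσ⟩ := Finset.not_subset.1 hSσ
    rw [hS] at hp
    obtain ⟨hp1, hp2⟩ := Finset.mem_filter.1 hp
    obtain ⟨hp3, hp4⟩ := Finset.mem_filter.1 hp1
    have hpc : c < f p := lt_of_le_of_ne hp4 (fun hh => hpσ ((h.on p hp3).1 hh.symm))
    have hall := h.ext_le' hle hp3 hpc hp2
    refine lt_of_le_of_ne (hall v hv) (fun heq => ?_)
    obtain ⟨w, hwV, hwc⟩ := properFace_ne hsup hF'.1.2
    have hb : BFace P (insert v S) := by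
      rw [P.bface_iff]
      refine ⟨?_, f', c', hall, ⟨w, (Finset.mem_filter.1 hwV).1, hwc⟩, ?_⟩
      · intro x hx
        rw [Finset.mem_insert] at hx
        rcases hx with rfl | hx
        · exact hv
        · rw [hS] at hx
          exact (Finset.mem_filter.1 (Finset.mem_filter.1 hx).1).1
      · intro x hx
        rw [Finset.mem_insert] at hx
        rcases hx with rfl | hx
        · exact heq
        · rw [hS] at hx
          exact (Finset.mem_filter.1 hx).2
    have hvS : v ∉ S := by
      intro hh
      rw [hS] at hh
      have := (Finset.mem_filter.1 (Finset.mem_filter.1 hh).1).2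
      linarith
    have := (P.sc hd).card_le ((P.bface_iff_Fc _).1 hb)
    rw [Finset.card_insert_of_notMem hvS, hSc] at this
    omega

end cut

lemma SPolytope.stacked {d : ℕ} (hd : 4 ≤ d) (n : ℕ) : ∀ P : SPolytope d, P.V.card = n →
    g2 P = 0 → IsStacked P := by
  induction n using Nat.strong_induction_on with
  | _ n ih =>
  intro P hn h0
  by_cases hc : P.V.card = d + 1
  · exact ⟨0, fun _ => P, hc, rfl, fun k => k.elim0⟩
  have hex : ∃ k : ℕ, ∃ σ f c, CD P σ f c ∧ (P.V.filter (fun v => c < f v)).card = k := by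
    obtain ⟨σ, h1, h2⟩ := P.exists_missing hd h0 hc
    obtain ⟨f, c, h3⟩ := h1.exists_cd (by omega) h2
    exact ⟨_, σ, f, c, h3, rfl⟩
  obtain ⟨σ, f, c, h, hk⟩ := Nat.find_spec hex
  have hmin : ∀ τ g e, CD P τ g e → (P.V.filter (fun v => c < f v)).card ≤
      (P.V.filter (fun v => e < g v)).card := by
    intro τ g e h'
    rw [hk]
    exact Nat.find_min' hex ⟨τ, g, e, h', rfl⟩
  clear hk
  have hsum := h.g2_add (by omega)
  have n1 := (h.up (by omega)).g2_nonneg (by omega)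
  have n2 := (h.neg.up (by omega)).g2_nonneg (by omega)
  have hQ0 : g2 (h.up (by omega)) = 0 := by omega
  have hR0 : g2 (h.neg.up (by omega)) = 0 := by omega
  have hQc : (h.up (by omega)).V.card = d + 1 := by
    by_contra hQc
    obtain ⟨τ, hτ, hτc⟩ := (h.up (by omega)).exists_missing hd hQ0 hQc
    have hτP : IsMissingFace P τ := by
      refine ⟨hτ.1.trans (Finset.filter_subset _ _), ?_, ?_⟩
      · intro hb
        exact hτ.2.1 ((h.up_bface (by omega) τ).2 ⟨hτ.1, Or.inl hb⟩)
      · intro ρ hρ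
        rcases ((h.up_bface (by omega) ρ).1 (hτ.2.2 ρ hρ)).2 with hh | hh
        · exact hh
        · have := Finset.card_lt_card hρ
          exact h.pair (by omega) hh (by omega)
    have hτσ : ¬ τ ⊆ σ := fun hh => hτ.2.1 ((h.up_bface (by omega) τ).2 ⟨hτ.1, Or.inr hh⟩)
    obtain ⟨p, hp, hpσ⟩ := Finset.not_subset.1 hτσ
    obtain ⟨hp1, hp2⟩ := Finset.mem_filter.1 (hτ.1 hp)
    have hpc : c < f p := lt_of_le_of_ne hp2 (fun hh => hpσ ((h.on p hp1).1 hh.symm))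
    have main : ∀ g e, CD P τ g e → (∀ v ∈ σ, g v ≤ e) → False := by
      intro g e h' hle
      have hlt : (P.V.filter (fun v => e < g v)).card < (P.V.filter (fun v => c < f v)).card := by
        apply Finset.card_lt_card
        have hpe := (h'.on p hp1).2 hp
        rw [Finset.ssubset_iff_of_subset]
        · exact ⟨p, Finset.mem_filter.2 ⟨hp1, hpc⟩, fun hh => by
            have := (Finset.mem_filter.1 hh).2
            linarith⟩
        · intro w hw
          obtain ⟨hw1, hw2⟩ := Finset.mem_filter.1 hw
          refine Finset.mem_filter.2 ⟨hw1, ?_⟩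
          by_contra hcon
          push Not at hcon
          rcases lt_or_eq_of_le hcon with hh | hh
          · have := h.ext_le hle hp1 hpc hpe hw1 hh
            linarith
          · have := hle w ((h.on w hw1).1 hh)
            linarith
      have := hmin τ g e h'
      omega
    obtain ⟨g, e, h'⟩ := hτP.exists_cd (by omega) hτc
    by_cases hle : ∀ v ∈ σ, g v ≤ e
    · exact main g e h' hle
    · push Not at hle
      obtain ⟨v, hv, hve⟩ := hle
      refine main _ _ h'.neg (fun u hu => ?_)
      by_contra hcon
      have hue : g u < e := by simpa using hcon
      refine h'.no_cross (by omega) (u := u) (v := v) ?_ hue hve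
      apply h.pair (by omega)
      · intro x hx
        rw [Finset.mem_insert, Finset.mem_singleton] at hx
        rcases hx with rfl | rfl <;> assumption
      · have := Finset.card_le_two (a := u) (b := v)
        omega
  -- exactly one vertex above
  obtain ⟨v, hv, hvc⟩ := h.hi
  have hvσ : v ∉ σ := fun hh => by
    have := (h.on v hv).2 hh; linarith
  have hQV : insert v σ = (h.up (by omega)).V := by
    apply Finset.eq_of_subset_of_card_le
    · intro x hx
      rw [Finset.mem_insert] at hx
      rcases hx with rfl | hx
      · exact Finset.mem_filter.2 ⟨hv, hvc.le⟩
      · exact h.sub hx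
    · rw [hQc, Finset.card_insert_of_notMem hvσ, h.card]
  have honly : ∀ w ∈ P.V, c < f w → w = v := by
    intro w hw hwc
    have : w ∈ (h.up (by omega)).V := Finset.mem_filter.2 ⟨hw, hwc.le⟩
    rw [← hQV, Finset.mem_insert] at this
    rcases this with hh | hh
    · exact hh
    · have := (h.on w hw).2 hh; linarith
  have hRV : P.V = insert v (h.neg.up (by omega)).V := by
    ext w
    rw [CD.up_V, Finset.mem_insert, Finset.mem_filter, LinearMap.neg_apply, neg_le_neg_iff]
    constructor
    · intro hw
      rcases le_or_gt (f w) c with hh | hh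
      · exact Or.inr ⟨hw, hh⟩
      · exact Or.inl (honly w hw hh)
    · rintro (rfl | hh)
      · exact hv
      · exact hh.1
  have hvR : v ∉ (h.neg.up (by omega)).V := by
    rw [CD.up_V, Finset.mem_filter, LinearMap.neg_apply, neg_le_neg_iff]
    intro hh; linarith [hh.2]
  have hlt : (h.neg.up (by omega)).V.card < n := by
    rw [← hn, hRV, Finset.card_insert_of_notMem hvR]; omega
  have hRs := ih _ hlt (h.neg.up (by omega)) rfl hR0
  refine hRs.step (v := v) ?_ ?_
  · rcases h.neg.beyond (by omega) hv (by simpa using hvc) with hh | ⟨w, w1, w2, w3⟩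
    · exact hh
    · exact absurd (honly w w1 (by simpa using w2)) w3
  · rw [polyBody, polyBody, convexHull_convexHull_union_left]
    conv_lhs => rw [hRV]
    rw [Finset.coe_insert, Set.union_singleton]


lemma interior_disj {d : ℕ} {A B : Set (Fin d → ℝ)} {f : (Fin d → ℝ) →ₗ[ℝ] ℝ} {c : ℝ} (hf : f ≠ 0)
    (hA : ∀ x ∈ A, c ≤ f x) (hB : ∀ x ∈ B, f x ≤ c) : interior A ∩ interior B = ∅ := by
  by_contra hne
  obtain ⟨x, hx⟩ := Set.nonempty_iff_ne_empty.2 hne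
  have hsurj : Function.Surjective f := LinearMap.surjective hf
  have hop : IsOpen (f '' (interior A ∩ interior B)) :=
    (LinearMap.isOpenMap_of_finiteDimensional f hsurj) _ (isOpen_interior.inter isOpen_interior)
  have heq : f '' (interior A ∩ interior B) = {c} := by
    ext t
    constructor
    · rintro ⟨y, ⟨h1, h2⟩, rfl⟩
      exact le_antisymm (hB y (interior_subset h2)) (hA y (interior_subset h1))
    · rintro rfl
      exact ⟨x, hx, le_antisymm (hB x (interior_subset hx.2)) (hA x (interior_subset hx.1))⟩
  rw [heq] at hop
  exact not_isOpen_singleton c hop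

lemma CD.exists_pos {d : ℕ} (hd : 4 ≤ d) {P : SPolytope d} (hcs : IsCS P)
    {σ : Finset (Fin d → ℝ)} (hm : IsMissingFace P σ) (hc : σ.card = d) :
    ∃ f c, CD P σ f c ∧ 0 < c := by
  obtain ⟨f, c, h⟩ := hm.exists_cd (by omega) hc
  rcases lt_trichotomy c 0 with h0 | h0 | h0
  · exact ⟨-f, -c, h.neg, by linarith⟩
  · exfalso
    obtain ⟨v, hv⟩ : σ.Nonempty := by rw [← Finset.card_pos]; omega
    have hvV := hm.1 hv
    have hv' : -v ∈ σ := by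
      rw [← h.on _ (hcs v hvV), map_neg, (h.on v hvV).2 hv, h0, neg_zero]
    have hb : BFace P {v, -v} := by
      apply h.pair (by omega)
      · intro x hx
        rw [Finset.mem_insert, Finset.mem_singleton] at hx
        rcases hx with rfl | rfl <;> assumption
      · have := Finset.card_le_two (a := v) (b := -v)
        omega
    exact hcs.no_antipodal hb (v := v) (by simp) (by simp)
  · exact ⟨f, c, h, h0⟩

/-- Let `d ≥ 4` and let `P` be a cs simplicial `d`-polytope with
`g₂(P) = C(d,2) - d` whose boundary complex has a missing facet. Then `P` decomposes as
`Q ∪ P' ∪ (-Q)` with pairwise disjoint interiors, where `Q ∩ P'` is a common facet `F`,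
`(-Q) ∩ P'` is the antipodal common facet `-F`, `Q ∩ (-Q) = ∅`, all vertices of `Q` and
`P'` are vertices of `P`, `Q` is stacked, and `P'` is cs with `g₂(P') = C(d,2) - d`. -/
theorem stmt8 {d : ℕ} (hd : 4 ≤ d) (P : SPolytope d) (hcs : IsCS P)
    (hg2 : g2 P = (d.choose 2 : ℤ) - (d : ℤ))
    (hmf : ∃ σ : Finset (Fin d → ℝ), IsMissingFace P σ ∧ σ.card = d) :
    ∃ (Q P' : SPolytope d) (F : Set (Fin d → ℝ)),
      polyBody P.V = polyBody Q.V ∪ polyBody P'.V ∪ ((fun x => -x) '' polyBody Q.V) ∧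
      interior (polyBody Q.V) ∩ interior (polyBody P'.V) = ∅ ∧
      interior (polyBody Q.V) ∩ interior ((fun x => -x) '' polyBody Q.V) = ∅ ∧
      interior (polyBody P'.V) ∩ interior ((fun x => -x) '' polyBody Q.V) = ∅ ∧
      polyBody Q.V ∩ polyBody P'.V = F ∧
      IsFacet Q F ∧ IsFacet P' F ∧
      ((fun x => -x) '' polyBody Q.V) ∩ polyBody P'.V = (fun x => -x) '' F ∧
      IsFacet P' ((fun x => -x) '' F) ∧
      polyBody Q.V ∩ ((fun x => -x) '' polyBody Q.V) = ∅ ∧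
      Q.V ⊆ P.V ∧ P'.V ⊆ P.V ∧
      IsStacked Q ∧ IsCS P' ∧ g2 P' = (d.choose 2 : ℤ) - (d : ℤ) := by
  obtain ⟨σ, hm, hc⟩ := hmf
  obtain ⟨f, c, h, hc0⟩ := CD.exists_pos hd hcs hm hc
  have hd1 : 1 ≤ d := by omega
  have hf0 : f ≠ 0 := by
    rintro rfl
    obtain ⟨v, hv, hvc⟩ := h.hi
    rw [LinearMap.zero_apply] at hvc
    linarith
  obtain ⟨τ, hτ⟩ : ∃ τ : Finset (Fin d → ℝ), τ = σ.image (fun x => -x) := ⟨_, rfl⟩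
  have hmem : ∀ x, x ∈ τ ↔ -x ∈ σ := by
    intro x
    rw [hτ, Finset.mem_image]
    constructor
    · rintro ⟨y, hy, rfl⟩; simpa using hy
    · intro hx; exact ⟨-x, hx, by simp⟩
  have hτc : τ.card = d := by rw [hτ, Finset.card_image_of_injective _ neg_injective, hc]
  have hfσ : ∀ v ∈ σ, f v = c := fun v hv => (h.on v (hm.1 hv)).2 hv
  have hfτ : ∀ v ∈ τ, f v = -c := fun v hv => by
    have := hfσ _ ((hmem v).1 hv)
    rw [map_neg] at this
    linarith
  have hτP : τ ⊆ P.V := fun x hx => by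
    have := hcs _ (hm.1 ((hmem x).1 hx))
    rwa [neg_neg] at this
  have V1 : ∀ v, v ∈ (h.neg.up hd1).V ↔ v ∈ P.V ∧ f v ≤ c := by
    intro v
    rw [CD.up_V, Finset.mem_filter, LinearMap.neg_apply, neg_le_neg_iff]
  have hτ1 : τ ⊆ (h.neg.up hd1).V := fun x hx => (V1 x).2 ⟨hτP hx, by rw [hfτ x hx]; linarith⟩
  have hm1 : IsMissingFace (h.neg.up hd1) τ := by
    refine ⟨hτ1, ?_, ?_⟩
    · intro hb
      rcases ((h.neg.up_bface hd1 τ).1 hb).2 with hb | hb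
      · have := hcs.bface hb
        apply hm.2.1
        convert this using 1
        rw [hτ, Finset.image_image]
        simp
      · obtain ⟨v, hv⟩ : τ.Nonempty := by rw [← Finset.card_pos]; omega
        have e1 := hfτ v hv
        have e2 := hfσ v (hb hv)
        linarith
    · intro ρ hρ
      rw [h.neg.up_bface]
      refine ⟨hρ.1.trans hτ1, Or.inl ?_⟩
      have hb : BFace P (ρ.image (fun x => -x)) := by
        apply h.pair (by omega)
        · intro x hx
          obtain ⟨y, hy, rfl⟩ := Finset.mem_image.1 hx
          exact (hmem y).1 (hρ.1 hy)
        · rw [Finset.card_image_of_injective _ neg_injective]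
          exact (Finset.card_lt_card hρ).trans_eq hτc
      have := hcs.bface hb
      rw [Finset.image_image] at this
      convert this using 1
      simp
  have h1 : CD (h.neg.up hd1) τ f (-c) := hm1.cd hd1 hτc hf0 hfτ
  have V2 : ∀ v, v ∈ (h1.up hd1).V ↔ v ∈ P.V ∧ f v ≤ c ∧ -c ≤ f v := by
    intro v
    rw [CD.up_V h1, Finset.mem_filter, V1, and_assoc]
  have hcs' : IsCS (h1.up hd1) := by
    intro v hv
    rw [V2] at hv ⊢
    refine ⟨hcs v hv.1, ?_, ?_⟩ <;> rw [map_neg] <;> linarith [hv.2.1, hv.2.2]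
  have k1 := h.g2_add (by omega)
  have k2 := h1.g2_add (by omega)
  have k3 := (h.up hd1).g2_nonneg (by omega)
  have k4 := (h1.neg.up hd1).g2_nonneg (by omega)
  have k5 := hcs'.g2_ge (by omega)
  -- bodies
  have B1 : polyBody (h.up hd1).V = {x ∈ polyBody P.V | c ≤ f x} := h.body_eq
  have B2 : polyBody (h.neg.up hd1).V = {x ∈ polyBody P.V | f x ≤ c} := by
    rw [CD.up_V, h.neg.body_eq]
    ext x
    simp
  have B3 : polyBody (h1.up hd1).V = {x ∈ polyBody P.V | f x ≤ c ∧ -c ≤ f x} := by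
    rw [CD.up_V h1, h1.body_eq, B2]
    ext x
    simp [and_assoc]
  have hnegP : ∀ x, x ∈ polyBody P.V → -x ∈ polyBody P.V := by
    intro x hx
    have : -x ∈ - polyBody P.V := by simpa using hx
    rw [polyBody, ← convexHull_neg] at this
    refine convexHull_mono ?_ this
    intro y hy
    have := hcs _ (Finset.mem_coe.1 (Set.mem_neg.1 hy))
    rwa [neg_neg] at this
  have B4 : (fun x => -x) '' polyBody (h.up hd1).V = {x ∈ polyBody P.V | f x ≤ -c} := by
    rw [B1]
    ext x
    constructor
    · rintro ⟨y, ⟨hy1, hy2⟩, rfl⟩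
      refine ⟨hnegP y hy1, ?_⟩
      rw [map_neg]; linarith
    · rintro ⟨hx1, hx2⟩
      refine ⟨-x, ⟨hnegP x hx1, ?_⟩, by simp⟩
      rw [map_neg]; linarith
  have F1 := h.up_facet hd1
  have F2 : IsFacet (h1.up hd1) (convexHull ℝ (σ : Set (Fin d → ℝ))) ∧
      convexHull ℝ (σ : Set (Fin d → ℝ)) = {y ∈ polyBody (h1.up hd1).V | f y = c} := by
    apply SPolytope.facet_of
    · intro v hv; exact ((V2 v).1 hv).2.1
    · obtain ⟨v, hv⟩ : τ.Nonempty := by rw [← Finset.card_pos]; omega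
      have e1 := hfτ v hv
      exact ⟨v, (V2 v).2 ⟨hτP hv, by linarith, by linarith⟩, by rw [e1]; linarith⟩
    · intro v
      rw [V2]
      constructor
      · exact fun hh => (h.on v hh.1.1).1 hh.2
      · intro hv
        have e1 := hfσ v hv
        exact ⟨⟨hm.1 hv, by linarith, by linarith⟩, e1⟩
    · exact hc
  have F3 := h1.up_facet hd1
  have hnegF : (fun x => -x) '' (convexHull ℝ (σ : Set (Fin d → ℝ))) =
      convexHull ℝ (τ : Set (Fin d → ℝ)) := by
    rw [Set.image_neg_eq_neg, ← convexHull_neg]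
    congr 1
    ext x
    rw [Set.mem_neg, Finset.mem_coe, Finset.mem_coe, hmem]
  refine ⟨h.up hd1, h1.up hd1, convexHull ℝ (σ : Set (Fin d → ℝ)), ?_, ?_, ?_, ?_, ?_, F1.1, F2.1,
    ?_, ?_, ?_, ?_, ?_, ?_, hcs', ?_⟩
  · rw [B4, B3, B1]
    ext x
    constructor
    · intro hx
      rcases le_total c (f x) with e1 | e1
      · exact Or.inl (Or.inl ⟨hx, e1⟩)
      · rcases le_total (-c) (f x) with e2 | e2
        · exact Or.inl (Or.inr ⟨hx, e1, e2⟩)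
        · exact Or.inr ⟨hx, e2⟩
    · rintro ((hx | hx) | hx) <;> exact hx.1
  · rw [B1, B3]
    exact interior_disj hf0 (fun x hx => hx.2) (fun x hx => hx.2.1)
  · rw [B4, B1]
    exact interior_disj (c := c) hf0 (fun x hx => hx.2) (fun x hx => by have := hx.2; linarith)
  · rw [B4, B3]
    exact interior_disj hf0 (fun x hx => hx.2.2) (fun x hx => hx.2)
  · rw [F2.2, B1, B3]
    ext x
    constructor
    · rintro ⟨hx, hy⟩
      exact ⟨hy, le_antisymm hy.2.1 hx.2⟩
    · rintro ⟨hx, hy⟩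
      exact ⟨⟨hx.1, hy.ge⟩, hx⟩
  · rw [hnegF, F3.2, B4, B3]
    ext x
    constructor
    · rintro ⟨hx, hy⟩
      refine ⟨hy, ?_⟩
      rw [LinearMap.neg_apply, neg_inj]
      exact le_antisymm hx.2 hy.2.2
    · rintro ⟨hx, hy⟩
      rw [LinearMap.neg_apply, neg_inj] at hy
      exact ⟨⟨hx.1, hy.le⟩, hx⟩
  · rw [hnegF]; exact F3.1
  · rw [B4, B1]
    ext x
    simp only [Set.mem_inter_iff, Set.mem_setOf_eq, Set.mem_empty_iff_false, iff_false]
    rintro ⟨⟨_, e1⟩, _, e2⟩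
    linarith
  · exact Finset.filter_subset _ _
  · intro v hv; exact ((V2 v).1 hv).1
  · exact SPolytope.stacked hd _ _ rfl (by omega)
  · omega
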